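/- arXiv:2204.03274 — 2 statements merged into one kernel-verified Lean document; each statement's English description precedes it below -/
import Mathlib

section
/- Fix λ ∈ (0,1]. Let φ be a continuous, bounded solution of the steady Whitham equation with wave speed ν ∈ [0,1] such that φ is even, nonconstant, strictly increasing on (−∞, 0], and satisfies ν − 1 ≤ φ(x) ≤ λν/2 for all x with φ(0) = λν/2. Then ν ∈ (0,1), and the Galilean transform φ_λ := φ + 1 − ν with μ_λ := 2 − ν has the following properties: φ_λ solves the steady Whitham equation with wave speed μ_λ ∈ (1,2); φ_λ is positive, even, and strictly decreasing on [0, ∞); 0 < φ_λ(x) ≤ μ_λ − 1 + λ·(1 − μ_λ/2) for all x, with equality exactly at x = 0; lim_{x→±∞} φ_λ(x) = 0; and there exists η > 0 such that the function x ↦ e^{η|x|}·φ_λ(x) is both integrable and bounded on ℝ. -/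
open Real Filter MeasureTheory

/-- The Whitham symbol `m(ξ) = √(tanh ξ / ξ)`, with `m 0 = 1`. -/
noncomputable def whithamSymbol (ξ : ℝ) : ℝ :=
  if ξ = 0 then 1 else Real.sqrt (Real.tanh ξ / ξ)

/-- The Whitham kernel, defined for `x ≠ 0` as the improper integral
`K(x) = (1/π)·lim_{R→∞} ∫₀^R m(ξ) cos(xξ) dξ`, and `K 0 = 0`. -/
noncomputable def whithamKernel (x : ℝ) : ℝ :=
  if x = 0 then 0 else
    limUnder atTop
      (fun R : ℝ => (1 / Real.pi) * ∫ ξ in (0:ℝ)..R, whithamSymbol ξ * Real.cos (x * ξ))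

/-- The convolution operator `Lf(x) = ∫_ℝ K(x−y) f(y) dy`. -/
noncomputable def Lop (K f : ℝ → ℝ) (x : ℝ) : ℝ := ∫ y : ℝ, K (x - y) * f y

open scoped Topology

lemma whithamSymbol_zero : whithamSymbol 0 = 1 := if_pos rfl

lemma whithamSymbol_of_ne {ξ : ℝ} (h : ξ ≠ 0) : whithamSymbol ξ = √(tanh ξ / ξ) := if_neg h

lemma whithamSymbol_nonneg (ξ : ℝ) : 0 ≤ whithamSymbol ξ := by
  unfold whithamSymbol
  split_ifs
  · exact zero_le_one
  · exact Real.sqrt_nonneg _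

lemma whithamSymbol_neg (ξ : ℝ) : whithamSymbol (-ξ) = whithamSymbol ξ := by
  simp [whithamSymbol, Real.tanh_neg, neg_div_neg_eq]

lemma whithamSymbol_le_rpow {ξ : ℝ} (h : 0 < ξ) : whithamSymbol ξ ≤ ξ ^ (-(1 / 2) : ℝ) := by
  rw [whithamSymbol_of_ne h.ne', Real.rpow_neg h.le, ← Real.sqrt_eq_rpow, ← Real.sqrt_inv]
  apply Real.sqrt_le_sqrt
  rw [← one_div]
  gcongr
  exact (tanh_lt_one ξ).le

lemma tanh_div_self_eq (ξ : ℝ) : tanh ξ / ξ = sinh ξ / (ξ * cosh ξ) := by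
  rw [Real.tanh_eq_sinh_div_cosh, div_div, mul_comm]

/-- On the positive axis the Whitham symbol is differentiable with nonpositive derivative. -/
lemma exists_hasDerivAt_whithamSymbol {ξ : ℝ} (h : 0 < ξ) :
    ∃ d ≤ 0, HasDerivAt whithamSymbol d ξ := by
  have hc := cosh_pos ξ
  have hs : 0 < sinh ξ := sinh_pos_iff.2 h
  have hpos : 0 < sinh ξ / (ξ * cosh ξ) := by positivity
  have h1 : HasDerivAt (fun ξ ↦ sinh ξ / (ξ * cosh ξ))
      ((cosh ξ * (ξ * cosh ξ) - sinh ξ * (1 * cosh ξ + ξ * sinh ξ)) / (ξ * cosh ξ) ^ 2) ξ :=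
    (Real.hasDerivAt_sinh ξ).div ((hasDerivAt_id' ξ).mul (Real.hasDerivAt_cosh ξ)) (by positivity)
  have h2 := h1.sqrt hpos.ne'
  refine ⟨_, ?_, h2.congr_of_eventuallyEq ?_⟩
  · apply div_nonpos_of_nonpos_of_nonneg _ (by positivity)
    apply div_nonpos_of_nonpos_of_nonneg _ (by positivity)
    have h3 : ξ ≤ sinh ξ := Real.self_le_sinh_iff.2 h.le
    have h4 := Real.one_le_cosh ξ
    nlinarith [Real.cosh_sq ξ, mul_le_mul h3 h4 zero_le_one hs.le]
  · filter_upwards [lt_mem_nhds h] with y hy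
    rw [whithamSymbol_of_ne hy.ne', tanh_div_self_eq]

/-- The Mittag-Leffler expansion of `ξ coth ξ`. -/
lemma tendsto_sum_coth {ξ : ℝ} (h : ξ ≠ 0) :
    Tendsto (fun N : ℕ ↦ 1 + ∑ n ∈ Finset.range N, 2 * ξ ^ 2 / (ξ ^ 2 + ((n + 1) * π) ^ 2))
      atTop (𝓝 (ξ / tanh ξ)) := by
  have hπ : (π : ℂ) ≠ 0 := by exact_mod_cast pi_ne_zero
  have hξ : (ξ : ℂ) ≠ 0 := by exact_mod_cast h
  have hI : (Complex.I * ξ / π : ℂ) ∈ Complex.integerComplement := by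
    rintro ⟨n, hn⟩
    have := congrArg Complex.im hn
    rw [mul_div_assoc, ← Complex.ofReal_div, Complex.I_mul_im, Complex.ofReal_re,
      Complex.intCast_im] at this
    exact div_ne_zero h pi_ne_zero this.symm
  have key := (tendsto_logDeriv_euler_cot_sub hI).const_mul (Complex.I * ξ / π)
  have hterm (n : ℕ) : Complex.I * ξ / π * cotTerm (Complex.I * ξ / π) n =
      ((2 * ξ ^ 2 / (ξ ^ 2 + ((n + 1) * π) ^ 2) : ℝ) : ℂ) := by
    have h1 : (Complex.I * ξ / π : ℂ) + (n + 1) ≠ 0 := by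
      simpa using Complex.integerComplement_add_ne_zero hI (n + 1)
    have h2 : (Complex.I * ξ / π : ℂ) - (n + 1) ≠ 0 := by
      have := Complex.integerComplement_add_ne_zero hI (-(n + 1))
      push_cast at this
      rwa [← sub_eq_add_neg] at this
    have h3 : (ξ : ℂ) ^ 2 + ((n + 1) * π) ^ 2 ≠ 0 := by
      have : ξ ^ 2 + ((n + 1) * π) ^ 2 ≠ 0 := by positivity
      exact_mod_cast this
    rw [cotTerm, div_add_div _ _ h2 h1, mul_div_assoc']
    push_cast
    rw [div_eq_div_iff (mul_ne_zero h2 h1) h3]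
    field_simp
    linear_combination (2 * ξ * π ^ 2 * (n + 1) ^ 2) * Complex.I_sq
  have hlim : Complex.I * ξ / π * (π * Complex.cot (π * (Complex.I * ξ / π)) -
      1 / (Complex.I * ξ / π)) = ((ξ / tanh ξ - 1 : ℝ) : ℂ) := by
    have hs : (Complex.sinh ξ) ≠ 0 := by
      rw [← Complex.ofReal_sinh]
      exact_mod_cast Real.sinh_ne_zero.2 h
    rw [mul_div_cancel₀ _ hπ, Complex.cot, mul_comm Complex.I, Complex.cos_mul_I,
      Complex.sin_mul_I, Real.tanh_eq_sinh_div_cosh]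
    push_cast
    have := Complex.I_ne_zero
    field_simp
  rw [hlim, funext fun N ↦ Finset.mul_sum (Finset.range N) _ (Complex.I * ξ / π : ℂ)] at key
  simp_rw [hterm, ← Complex.ofReal_sum] at key
  rw [tendsto_ofReal_iff] at key
  simpa using key.const_add 1

/-- The symbol of the approximating probability measures. -/
noncomputable def whithamSymbolApprox (N : ℕ) (ξ : ℝ) : ℝ :=
  (√(1 + ∑ n ∈ Finset.range N, 2 * ξ ^ 2 / (ξ ^ 2 + ((n + 1) * π) ^ 2)))⁻¹

lemma tendsto_whithamSymbolApprox (ξ : ℝ) :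
    Tendsto (fun N ↦ whithamSymbolApprox N ξ) atTop (𝓝 (whithamSymbol ξ)) := by
  rcases eq_or_ne ξ 0 with rfl | h
  · simp [whithamSymbolApprox, whithamSymbol_zero]
  · rw [whithamSymbol_of_ne h, ← inv_div, Real.sqrt_inv]
    have h0 : 0 < ξ / tanh ξ := by
      rw [← inv_div, tanh_div_self_eq, inv_pos]
      rcases h.lt_or_gt with h | h
      · have := sinh_neg_iff.2 h
        exact div_pos_of_neg_of_neg this (mul_neg_of_neg_of_pos h (cosh_pos _))
      · have := sinh_pos_iff.2 h
        have := cosh_pos ξ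
        positivity
    exact ((Real.continuous_sqrt.tendsto _).comp (tendsto_sum_coth h)).inv₀
      (Real.sqrt_pos.2 h0).ne'

lemma tendsto_whithamSymbol_zero : Tendsto whithamSymbol (𝓝 0) (𝓝 1) := by
  have hd : HasDerivAt tanh 1 0 := by
    have := (Real.hasDerivAt_sinh 0).div (Real.hasDerivAt_cosh 0) (by simp)
    simp only [cosh_zero, sinh_zero] at this
    have hfun : tanh = sinh / cosh := funext Real.tanh_eq_sinh_div_cosh
    rw [hfun]
    simpa using this
  rw [hasDerivAt_iff_tendsto_slope_zero] at hd
  have h1 : Tendsto whithamSymbol (𝓝[≠] 0) (𝓝 1) := by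
    have := (Real.continuous_sqrt.tendsto _).comp hd
    rw [Real.sqrt_one] at this
    refine this.congr' ?_
    filter_upwards [self_mem_nhdsWithin] with x hx
    simp [whithamSymbol_of_ne hx, div_eq_inv_mul]
  rw [← whithamSymbol_zero] at h1 ⊢
  exact continuousAt_iff_punctured_nhds.2 h1

lemma continuous_whithamSymbol : Continuous whithamSymbol := by
  rw [continuous_iff_continuousAt]
  intro ξ
  rcases lt_trichotomy ξ 0 with h | rfl | h
  · obtain ⟨d, -, hd⟩ := exists_hasDerivAt_whithamSymbol (neg_pos.2 h)
    have := ContinuousAt.comp (f := fun x : ℝ ↦ -x) hd.continuousAt continuous_neg.continuousAt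
    refine this.congr (.of_forall fun x ↦ whithamSymbol_neg x)
  · simpa [ContinuousAt, whithamSymbol_zero] using tendsto_whithamSymbol_zero
  · obtain ⟨d, -, hd⟩ := exists_hasDerivAt_whithamSymbol h
    exact hd.continuousAt

lemma whithamSymbol_le_one (ξ : ℝ) : whithamSymbol ξ ≤ 1 := by
  refine le_of_tendsto (tendsto_whithamSymbolApprox ξ) (.of_forall fun N ↦ ?_)
  refine inv_le_one_of_one_le₀ (Real.one_le_sqrt.2 ?_)
  have : 0 ≤ ∑ n ∈ Finset.range N, 2 * ξ ^ 2 / (ξ ^ 2 + ((n + 1) * π) ^ 2) :=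
    Finset.sum_nonneg fun n _ ↦ by positivity
  linarith

/-- The Laplace distribution with rate `b`. -/
noncomputable def laplaceMeasure (b : ℝ) : Measure ℝ :=
  volume.withDensity fun x ↦ ENNReal.ofReal (b / 2 * exp (-b * |x|))

lemma integral_cexp_mul_laplace {b : ℝ} {z : ℂ} (hz : |z.re| < b) :
    Integrable (fun x : ℝ ↦ ((b / 2 * exp (-b * |x|) : ℝ) : ℂ) * Complex.exp (z * x)) ∧
    ∫ x : ℝ, ((b / 2 * exp (-b * |x|) : ℝ) : ℂ) * Complex.exp (z * x) =
      b ^ 2 / (b ^ 2 - z ^ 2) := by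
  rw [abs_lt] at hz
  have h1 : (z - b).re < 0 := by simp; linarith
  have h2 : 0 < (z + b).re := by simp; linarith
  have e1 : Set.EqOn (fun x : ℝ ↦ ((b / 2 * exp (-b * |x|) : ℝ) : ℂ) * Complex.exp (z * x))
      (fun x : ℝ ↦ b / 2 * Complex.exp ((z - b) * x)) (Set.Ioi 0) := by
    intro x hx
    simp only [abs_of_pos (Set.mem_Ioi.1 hx)]
    push_cast
    rw [mul_assoc, ← Complex.exp_add]
    ring_nf
  have e2 : Set.EqOn (fun x : ℝ ↦ ((b / 2 * exp (-b * |x|) : ℝ) : ℂ) * Complex.exp (z * x))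
      (fun x : ℝ ↦ b / 2 * Complex.exp ((z + b) * x)) (Set.Iic 0) := by
    intro x hx
    simp only [abs_of_nonpos (Set.mem_Iic.1 hx)]
    push_cast
    rw [mul_assoc, ← Complex.exp_add]
    ring_nf
  have i1 := IntegrableOn.congr_fun
    ((integrableOn_exp_mul_complex_Ioi h1 0).const_mul (b / 2 : ℂ)) e1.symm measurableSet_Ioi
  have i2 := IntegrableOn.congr_fun
    ((integrableOn_exp_mul_complex_Iic h2 0).const_mul (b / 2 : ℂ)) e2.symm measurableSet_Iic
  constructor
  · rw [← integrableOn_univ, ← Set.Iic_union_Ioi (a := (0 : ℝ))]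
    exact i2.union i1
  · rw [← intervalIntegral.integral_Iic_add_Ioi i2 i1, setIntegral_congr_fun measurableSet_Ioi e1,
      setIntegral_congr_fun measurableSet_Iic e2, integral_const_mul, integral_const_mul,
      integral_exp_mul_complex_Ioi h1, integral_exp_mul_complex_Iic h2]
    have h3 : z - b ≠ 0 := fun h ↦ by simp [h] at h1
    have h4 : z + b ≠ 0 := fun h ↦ by simp [h] at h2
    have h5 : (b : ℂ) ^ 2 - z ^ 2 ≠ 0 := by
      rw [show (b : ℂ) ^ 2 - z ^ 2 = -((z - b) * (z + b)) by ring]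
      exact neg_ne_zero.2 (mul_ne_zero h3 h4)
    simp only [Complex.ofReal_zero, mul_zero, Complex.exp_zero]
    field_simp
    ring

/-- The two-sided Laplace transform of a measure, at a real point. -/
noncomputable def bilateralLaplace (μ : Measure ℝ) (η : ℝ) : ENNReal :=
  ∫⁻ x, ENNReal.ofReal (exp (η * x)) ∂μ

lemma bilateralLaplace_zero (μ : Measure ℝ) : bilateralLaplace μ 0 = μ Set.univ := by
  simp [bilateralLaplace]

lemma bilateralLaplace_smul (c : ENNReal) (μ : Measure ℝ) (η : ℝ) :
    bilateralLaplace (c • μ) η = c * bilateralLaplace μ η := by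
  simp [bilateralLaplace]

lemma bilateralLaplace_conv (μ ρ : Measure ℝ) [SFinite ρ] (η : ℝ) :
    bilateralLaplace (μ ∗ ρ) η = bilateralLaplace μ η * bilateralLaplace ρ η := by
  unfold bilateralLaplace
  rw [Measure.lintegral_conv (by fun_prop)]
  simp_rw [mul_add, exp_add, ENNReal.ofReal_mul (exp_pos _).le]
  simp_rw [lintegral_const_mul _ (show Measurable fun x ↦ ENNReal.ofReal (exp (η * x)) by fun_prop)]
  rw [lintegral_mul_const _ (by fun_prop)]

lemma bilateralLaplace_laplaceMeasure {b : ℝ} (hb : 0 < b) {η : ℝ} (hη : |η| < b) :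
    bilateralLaplace (laplaceMeasure b) η = ENNReal.ofReal (b ^ 2 / (b ^ 2 - η ^ 2)) := by
  obtain ⟨hi, he⟩ := integral_cexp_mul_laplace (z := η) (by simpa using hη)
  have hcast : (fun x : ℝ ↦ ((b / 2 * exp (-b * |x|) : ℝ) : ℂ) * Complex.exp (η * x)) =
      fun x ↦ ((b / 2 * exp (-b * |x|) * exp (η * x) : ℝ) : ℂ) := by
    ext x; push_cast; rfl
  rw [hcast] at hi he
  rw [integral_complex_ofReal] at he
  have hi' : Integrable fun x ↦ b / 2 * exp (-b * |x|) * exp (η * x) := by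
    simpa only [RCLike.re_to_complex, Complex.ofReal_re] using hi.re
  rw [bilateralLaplace, laplaceMeasure, lintegral_withDensity_eq_lintegral_mul _ (by fun_prop)
    (by fun_prop)]
  simp only [Pi.mul_apply]
  simp_rw [← ENNReal.ofReal_mul (show 0 ≤ b / 2 * exp (-b * |_|) by positivity)]
  rw [← ofReal_integral_eq_lintegral_ofReal hi' (.of_forall fun x ↦ by positivity)]
  congr 1
  exact_mod_cast he

lemma charFun_laplaceMeasure {b : ℝ} (hb : 0 < b) (ξ : ℝ) :
    charFun (laplaceMeasure b) ξ = ((b ^ 2 / (b ^ 2 + ξ ^ 2) : ℝ) : ℂ) := by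
  obtain ⟨hi, he⟩ := integral_cexp_mul_laplace (z := ξ * Complex.I) (by simpa using hb)
  rw [charFun_apply_real, laplaceMeasure, integral_withDensity_eq_integral_toReal_smul (by fun_prop)
    (by simp)]
  have hpos (x : ℝ) : 0 ≤ b / 2 * exp (-b * |x|) := by positivity
  simp_rw [ENNReal.toReal_ofReal (hpos _), Complex.real_smul,
    mul_right_comm (ξ : ℂ) _ Complex.I]
  rw [he, mul_pow, Complex.I_sq]
  push_cast
  ring

instance isFiniteMeasure_laplaceMeasure {b : ℝ} : IsFiniteMeasure (laplaceMeasure b) := by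
  constructor
  rcases le_or_gt b 0 with hb | hb
  · have (x : ℝ) : ENNReal.ofReal (b / 2 * exp (-b * |x|)) = 0 :=
      ENNReal.ofReal_of_nonpos (mul_nonpos_of_nonpos_of_nonneg (by linarith) (exp_pos _).le)
    simp only [laplaceMeasure, this]
    simp
  · rw [← bilateralLaplace_zero, bilateralLaplace_laplaceMeasure hb (by simpa)]
    exact ENNReal.ofReal_lt_top

/-- Convolution powers of a measure. -/
noncomputable def convPow (ν : Measure ℝ) : ℕ → Measure ℝ
  | 0 => Measure.dirac 0
  | k + 1 => ν ∗ convPow ν k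

instance isFiniteMeasure_convPow (ν : Measure ℝ) [IsFiniteMeasure ν] (k : ℕ) :
    IsFiniteMeasure (convPow ν k) := by
  induction k with
  | zero => unfold convPow; infer_instance
  | succ k ih => unfold convPow; infer_instance

lemma bilateralLaplace_convPow (ν : Measure ℝ) [IsFiniteMeasure ν] (k : ℕ) (η : ℝ) :
    bilateralLaplace (convPow ν k) η = bilateralLaplace ν η ^ k := by
  induction k with
  | zero => simp [convPow, bilateralLaplace]
  | succ k ih => rw [convPow, bilateralLaplace_conv, ih, pow_succ']

lemma charFun_convPow (ν : Measure ℝ) [IsFiniteMeasure ν] (k : ℕ) (ξ : ℝ) :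
    charFun (convPow ν k) ξ = charFun ν ξ ^ k := by
  induction k with
  | zero => simp [convPow]
  | succ k ih => rw [convPow, charFun_conv, ih, pow_succ']

/-- The Taylor coefficients of `(1 - x) ^ (-1/2)`. -/
noncomputable def invSqrtCoeff (k : ℕ) : ℝ := Ring.choose ((1 / 2 : ℝ) + k - 1) k

lemma invSqrtCoeff_nonneg (k : ℕ) : 0 ≤ invSqrtCoeff k := by
  have h := Ring.factorial_nsmul_multichoose_eq_ascPochhammer (1 / 2 : ℝ) k
  rw [Ring.multichoose_eq, Polynomial.ascPochhammer_smeval_eq_eval, nsmul_eq_mul] at h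
  have h1 : (0 : ℝ) < k.factorial := by positivity
  have h2 := ascPochhammer_pos k (1 / 2 : ℝ) (by norm_num)
  rw [← h] at h2
  exact (pos_of_mul_pos_right h2 h1.le).le

lemma hasSum_invSqrtCoeff {x : ℝ} (hx : |x| < 1) :
    HasSum (fun k ↦ invSqrtCoeff k * x ^ k) (√(1 - x))⁻¹ := by
  have h := (Real.one_div_one_sub_rpow_hasFPowerSeriesOnBall_zero (1 / 2)).hasSum (y := x)
    (by simpa [enorm_eq_nnnorm, ← NNReal.coe_lt_coe] using hx)
  simpa [FormalMultilinearSeries.ofScalars_apply_eq, Real.sqrt_eq_rpow, invSqrtCoeff, mul_comm]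
    using h

/-- The mixture of convolution powers of `ν` with characteristic function `(1 - ν̂) ^ (-1/2)`. -/
noncomputable def invSqrtMixture (ν : Measure ℝ) : Measure ℝ :=
  Measure.sum fun k ↦ ENNReal.ofReal (invSqrtCoeff k) • convPow ν k

lemma bilateralLaplace_invSqrtMixture (ν : Measure ℝ) [IsFiniteMeasure ν] {η g : ℝ} (hg0 : 0 ≤ g)
    (hg1 : g < 1) (hν : bilateralLaplace ν η = ENNReal.ofReal g) :
    bilateralLaplace (invSqrtMixture ν) η = ENNReal.ofReal (√(1 - g))⁻¹ := by
  have hs := hasSum_invSqrtCoeff (abs_lt.2 ⟨by linarith, hg1⟩)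
  rw [bilateralLaplace, invSqrtMixture, lintegral_sum_measure]
  change ∑' k, bilateralLaplace _ η = _
  simp_rw [bilateralLaplace_smul, bilateralLaplace_convPow, hν, ← ENNReal.ofReal_pow hg0,
    ← ENNReal.ofReal_mul (invSqrtCoeff_nonneg _)]
  rw [← ENNReal.ofReal_tsum_of_nonneg (fun k ↦ mul_nonneg (invSqrtCoeff_nonneg k)
    (pow_nonneg hg0 k)) hs.summable, hs.tsum_eq]

lemma charFun_invSqrtMixture (ν : Measure ℝ) [IsFiniteMeasure ν]
    [IsFiniteMeasure (invSqrtMixture ν)] {ξ g : ℝ} (hg0 : 0 ≤ g)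
    (hg1 : g < 1) (hν : charFun ν ξ = g) :
    charFun (invSqrtMixture ν) ξ = ((√(1 - g))⁻¹ : ℝ) := by
  have hs := hasSum_invSqrtCoeff (abs_lt.2 ⟨by linarith, hg1⟩)
  have hi : Integrable (fun x : ℝ ↦ Complex.exp (ξ * x * Complex.I)) (invSqrtMixture ν) := by
    refine (integrable_const (1 : ℝ)).mono' (by fun_prop) (.of_forall fun x ↦ ?_)
    rw [← Complex.ofReal_mul, Complex.norm_exp_ofReal_mul_I]
  have h2 := hasSum_integral_measure hi
  rw [charFun_apply_real]
  refine h2.unique ?_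
  refine (Complex.hasSum_ofReal.2 hs).congr_fun fun k ↦ ?_
  rw [integral_smul_measure, ← charFun_apply_real, charFun_convPow, hν,
    ENNReal.toReal_ofReal (invSqrtCoeff_nonneg k), Complex.real_smul]
  push_cast
  rfl

/-- The normalized finite superposition of Laplace distributions with rates `(n + 1)π`, `n < N`. -/
noncomputable def laplaceSuperposition (N : ℕ) : Measure ℝ :=
  ∑ n ∈ Finset.range N, ENNReal.ofReal (2 / (2 * N + 1)) • laplaceMeasure ((n + 1) * π)

lemma bilateralLaplace_laplaceSuperposition (N : ℕ) {η : ℝ} (hη : |η| < π) :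
    bilateralLaplace (laplaceSuperposition N) η = ENNReal.ofReal
      (2 / (2 * N + 1) *
        ∑ n ∈ Finset.range N, ((n + 1) * π) ^ 2 / (((n + 1) * π) ^ 2 - η ^ 2)) := by
  have hlt (n : ℕ) : |η| < (n + 1) * π := by nlinarith [pi_pos, n.cast_nonneg (α := ℝ)]
  have hsub (n : ℕ) : 0 < ((n + 1) * π) ^ 2 - η ^ 2 := by
    have := sq_lt_sq' (by linarith [hlt n, abs_nonneg η]) (hlt n)
    rw [sq_abs] at this
    linarith
  rw [bilateralLaplace, laplaceSuperposition, lintegral_finsetSum_measure, Finset.mul_sum,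
    ENNReal.ofReal_sum_of_nonneg
      fun n _ ↦ mul_nonneg (by positivity) (div_nonneg (by positivity) (hsub n).le)]
  refine Finset.sum_congr rfl fun n _ ↦ ?_
  change bilateralLaplace _ η = _
  rw [bilateralLaplace_smul, bilateralLaplace_laplaceMeasure (by positivity) (hlt n),
    ENNReal.ofReal_mul (by positivity)]

instance isFiniteMeasure_laplaceSuperposition (N : ℕ) :
    IsFiniteMeasure (laplaceSuperposition N) := by
  constructor
  rw [← bilateralLaplace_zero, bilateralLaplace_laplaceSuperposition N (by simpa using pi_pos)]
  exact ENNReal.ofReal_lt_top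

lemma charFun_laplaceSuperposition (N : ℕ) (ξ : ℝ) :
    charFun (laplaceSuperposition N) ξ = ((2 / (2 * N + 1) *
      ∑ n ∈ Finset.range N, ((n + 1) * π) ^ 2 / (((n + 1) * π) ^ 2 + ξ ^ 2) : ℝ) : ℂ) := by
  have hi (n : ℕ) : Integrable (fun x : ℝ ↦ Complex.exp (ξ * x * Complex.I))
      (ENNReal.ofReal (2 / (2 * N + 1)) • laplaceMeasure ((n + 1) * π)) := by
    have : IsFiniteMeasure (ENNReal.ofReal (2 / (2 * N + 1)) • laplaceMeasure ((n + 1) * π)) :=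
      Measure.smul_finite _ ENNReal.ofReal_ne_top
    refine (integrable_const (1 : ℝ)).mono' (by fun_prop) (.of_forall fun x ↦ ?_)
    rw [← Complex.ofReal_mul, Complex.norm_exp_ofReal_mul_I]
  rw [charFun_apply_real, laplaceSuperposition, integral_finsetSum_measure fun n _ ↦ hi n,
    Finset.mul_sum, Complex.ofReal_sum]
  refine Finset.sum_congr rfl fun n _ ↦ ?_
  rw [integral_smul_measure, ← charFun_apply_real, charFun_laplaceMeasure (by positivity),
    ENNReal.toReal_ofReal (by positivity), Complex.real_smul]
  push_cast
  rfl

/-- The probability measure with characteristic function `whithamSymbolApprox N`. -/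
noncomputable def whithamMeasureApprox (N : ℕ) : Measure ℝ :=
  ENNReal.ofReal (√(2 * N + 1))⁻¹ • invSqrtMixture (laplaceSuperposition N)

lemma two_mul_add_one_mul_one_sub (N : ℕ) {s : ℝ} (hs : ∀ n : ℕ, ((n + 1) * π) ^ 2 + s ≠ 0) :
    (2 * N + 1 : ℝ) * (1 - 2 / (2 * N + 1) *
      ∑ n ∈ Finset.range N, ((n + 1) * π) ^ 2 / (((n + 1) * π) ^ 2 + s)) =
    1 + ∑ n ∈ Finset.range N, 2 * s / (((n + 1) * π) ^ 2 + s) := by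
  have h1 : ∑ n ∈ Finset.range N, 2 * s / (((n + 1) * π) ^ 2 + s) =
      2 * (N : ℝ) - 2 * ∑ n ∈ Finset.range N, ((n + 1) * π) ^ 2 / (((n + 1) * π) ^ 2 + s) := by
    rw [Finset.mul_sum, eq_sub_iff_add_eq, ← Finset.sum_add_distrib]
    have (n : ℕ) : 2 * s / (((n + 1) * π) ^ 2 + s) +
        2 * (((n + 1) * π) ^ 2 / (((n + 1) * π) ^ 2 + s)) = 2 := by
      rw [← mul_div_assoc, ← add_div, ← mul_add, add_comm s, mul_div_cancel_right₀ _ (hs n)]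
    simp only [this, Finset.sum_const, Finset.card_range, nsmul_eq_mul, mul_comm (N : ℝ)]
  have h2 : (2 * N + 1 : ℝ) ≠ 0 := by positivity
  rw [h1, mul_sub, ← mul_assoc, mul_div_cancel₀ _ h2]
  ring

lemma sum_two_div_le (N : ℕ) {η : ℝ} (hη : |η| ≤ 1) :
    ∑ n ∈ Finset.range N, 2 * η ^ 2 / (((n + 1) * π) ^ 2 - η ^ 2) ≤ 1 / 2 := by
  have hη2 : η ^ 2 ≤ 1 := (sq_le_one_iff_abs_le_one η).2 hη
  calc _ ≤ ∑ n ∈ Finset.range N, 1 / 4 * (1 / ((n + 1 : ℕ) : ℝ) ^ 2) := by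
        refine Finset.sum_le_sum fun n _ ↦ ?_
        have hn : (1 : ℝ) ≤ (n + 1) ^ 2 := by nlinarith [n.cast_nonneg (α := ℝ)]
        have hπ : 9 ≤ π ^ 2 := by nlinarith [pi_gt_three]
        have h8 : 8 * (n + 1 : ℝ) ^ 2 ≤ ((n + 1) * π) ^ 2 - η ^ 2 := by nlinarith
        push_cast
        rw [div_mul_div_comm, div_le_div_iff₀ (by nlinarith) (by positivity)]
        nlinarith
    _ = 1 / 4 * ∑ n ∈ Finset.range N, 1 / ((n + 1 : ℕ) : ℝ) ^ 2 := by rw [Finset.mul_sum]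
    _ ≤ 1 / 4 * (π ^ 2 / 6) := by
        have h := sum_le_hasSum (Finset.range (N + 1)) (fun n _ ↦ by positivity) hasSum_zeta_two
        rw [Finset.sum_range_succ'] at h
        simp only [Nat.cast_zero, ne_eq, OfNat.ofNat_ne_zero, not_false_eq_true, zero_pow, div_zero,
          add_zero] at h
        gcongr
    _ ≤ 1 / 2 := by nlinarith [pi_lt_d2, pi_pos]

lemma bilateralLaplace_whithamMeasureApprox (N : ℕ) {η : ℝ} (hη : |η| ≤ 1) :
    bilateralLaplace (whithamMeasureApprox N) η = ENNReal.ofReal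
      (√(1 - ∑ n ∈ Finset.range N, 2 * η ^ 2 / (((n + 1) * π) ^ 2 - η ^ 2)))⁻¹ := by
  have hη' : |η| < π := by linarith [pi_gt_three]
  have hη2 : η ^ 2 ≤ 1 := (sq_le_one_iff_abs_le_one η).2 hη
  have hpos (n : ℕ) : 0 < ((n + 1) * π) ^ 2 - η ^ 2 := by
    have : 3 < (n + 1) * π := by nlinarith [n.cast_nonneg (α := ℝ), pi_gt_three]
    nlinarith
  have hid := two_mul_add_one_mul_one_sub N (s := -η ^ 2)
    (fun n ↦ by rw [← sub_eq_add_neg]; exact (hpos n).ne')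
  simp only [← sub_eq_add_neg, mul_neg, neg_div, Finset.sum_neg_distrib] at hid
  have hN : (0 : ℝ) < 2 * N + 1 := by positivity
  have hg1 : 0 < 1 - 2 / (2 * N + 1 : ℝ) *
      ∑ n ∈ Finset.range N, ((n + 1) * π) ^ 2 / (((n + 1) * π) ^ 2 - η ^ 2) := by
    refine pos_of_mul_pos_right (a := 2 * (N : ℝ) + 1) ?_ hN.le
    rw [hid]
    linarith [sum_two_div_le N hη]
  rw [whithamMeasureApprox, bilateralLaplace_smul, bilateralLaplace_invSqrtMixture _
      (mul_nonneg (by positivity) (Finset.sum_nonneg fun n _ ↦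
        div_nonneg (by positivity) (hpos n).le)) (by linarith)
      (bilateralLaplace_laplaceSuperposition N hη'),
    ← ENNReal.ofReal_mul (by positivity), ← mul_inv, ← Real.sqrt_mul hN.le, hid]

lemma bilateralLaplace_whithamMeasureApprox_le (N : ℕ) {η : ℝ} (hη : |η| ≤ 1) :
    bilateralLaplace (whithamMeasureApprox N) η ≤ 2 := by
  rw [bilateralLaplace_whithamMeasureApprox N hη, ← ENNReal.ofReal_ofNat]
  refine ENNReal.ofReal_le_ofReal (inv_le_of_inv_le₀ (by norm_num) (Real.le_sqrt_of_sq_le ?_))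
  linarith [sum_two_div_le N hη]

instance isProbabilityMeasure_whithamMeasureApprox (N : ℕ) :
    IsProbabilityMeasure (whithamMeasureApprox N) :=
  ⟨by rw [← bilateralLaplace_zero, bilateralLaplace_whithamMeasureApprox N (by simp)]; simp⟩

lemma charFun_whithamMeasureApprox (N : ℕ) (ξ : ℝ) :
    charFun (whithamMeasureApprox N) ξ = whithamSymbolApprox N ξ := by
  have hN : (0 : ℝ) < 2 * N + 1 := by positivity
  have : IsFiniteMeasure (invSqrtMixture (laplaceSuperposition N)) := by
    have h := measure_lt_top (whithamMeasureApprox N) Set.univ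
    rw [whithamMeasureApprox, Measure.smul_apply, smul_eq_mul] at h
    exact ⟨ENNReal.lt_top_of_mul_ne_top_right h.ne (by simpa using hN)⟩
  have hid := two_mul_add_one_mul_one_sub N (s := ξ ^ 2) (fun n ↦ by positivity)
  have hg1 : 0 < 1 - 2 / (2 * N + 1 : ℝ) *
      ∑ n ∈ Finset.range N, ((n + 1) * π) ^ 2 / (((n + 1) * π) ^ 2 + ξ ^ 2) := by
    refine pos_of_mul_pos_right (a := 2 * (N : ℝ) + 1) ?_ hN.le
    rw [hid]
    exact add_pos_of_pos_of_nonneg one_pos (Finset.sum_nonneg fun n _ ↦ by positivity)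
  rw [whithamMeasureApprox, charFun_apply_real, integral_smul_measure, ← charFun_apply_real,
    charFun_invSqrtMixture _ (mul_nonneg (by positivity) (Finset.sum_nonneg fun n _ ↦
      by positivity)) (by linarith) (charFun_laplaceSuperposition N ξ),
    ENNReal.toReal_ofReal (by positivity), Complex.real_smul, ← Complex.ofReal_mul, ← mul_inv,
    ← Real.sqrt_mul hN.le, hid, whithamSymbolApprox]
  simp_rw [add_comm (ξ ^ 2)]

lemma bilateralLaplace_le_of_tendsto {ι : Type*} {l : Filter ι} [l.NeBot]
    {P : ι → ProbabilityMeasure ℝ} {μ : ProbabilityMeasure ℝ} (h : Tendsto P l (𝓝 μ)) {η : ℝ}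
    {C : ENNReal} (hC : ∀ i, bilateralLaplace (P i) η ≤ C) :
    bilateralLaplace μ η ≤ C := by
  rw [ProbabilityMeasure.tendsto_iff_forall_lintegral_tendsto] at h
  have key (n : ℕ) : ∫⁻ x, min (ENNReal.ofReal (exp (η * x))) n ∂(μ : Measure ℝ) ≤ C := by
    let f : BoundedContinuousFunction ℝ NNReal := BoundedContinuousFunction.mkOfBound
      ⟨fun x ↦ min (exp (η * x)).toNNReal n, by fun_prop⟩ n fun x y ↦ by
        rw [NNReal.dist_eq, abs_le]
        have (z : ℝ) : ((min (exp (η * z)).toNNReal n : NNReal) : ℝ) ≤ n :=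
          NNReal.coe_le_coe.2 (min_le_right _ _)
        constructor <;> simp only [ContinuousMap.coe_mk] <;>
          linarith [this x, this y, (min (exp (η * x)).toNNReal n).coe_nonneg,
            (min (exp (η * y)).toNNReal n).coe_nonneg]
    have hf (x : ℝ) : (f x : ENNReal) = min (ENNReal.ofReal (exp (η * x))) n := by
      change ((min (exp (η * x)).toNNReal n : NNReal) : ENNReal) = _
      rw [ENNReal.coe_min]
      rfl
    simp_rw [← hf]
    refine le_of_tendsto (h f) (.of_forall fun i ↦ (lintegral_mono fun x ↦ ?_).trans (hC i))
    rw [hf]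
    exact min_le_left _ _
  have hsup (x : ℝ) : ENNReal.ofReal (exp (η * x)) =
      ⨆ n : ℕ, min (ENNReal.ofReal (exp (η * x))) n := by
    rw [← inf_iSup_eq, ENNReal.iSup_natCast, inf_top_eq]
  rw [bilateralLaplace, lintegral_congr hsup, lintegral_iSup
    (f := fun (n : ℕ) x ↦ min (ENNReal.ofReal (exp (η * x))) n) (fun n ↦ by fun_prop)
    fun m n hmn x ↦ min_le_min_left _ (by exact_mod_cast hmn)]
  exact iSup_le key

/-- The Whitham symbol is the characteristic function of a probability measure with
exponential moments. -/
theorem exists_measure_charFun_eq_whithamSymbol :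
    ∃ μ : Measure ℝ, IsProbabilityMeasure μ ∧ (∀ ξ, charFun μ ξ = whithamSymbol ξ) ∧
      bilateralLaplace μ 1 ≤ 2 ∧ bilateralLaplace μ (-1) ≤ 2 := by
  let P (N : ℕ) : ProbabilityMeasure ℝ := ⟨whithamMeasureApprox N, inferInstance⟩
  have hchar (ξ : ℝ) : Tendsto (fun N ↦ charFun (whithamMeasureApprox N) ξ) atTop
      (𝓝 (whithamSymbol ξ : ℂ)) := by
    simp_rw [charFun_whithamMeasureApprox]
    exact (Complex.continuous_ofReal.tendsto _).comp (tendsto_whithamSymbolApprox ξ)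
  have htight := isTightMeasureSet_of_tendsto_charFun
    (Complex.continuous_ofReal.comp continuous_whithamSymbol).continuousAt hchar
  have hcomp : IsCompact (closure (Set.range P)) := by
    apply isCompact_closure_of_isTightMeasureSet
    convert htight
    ext μ
    constructor
    · rintro ⟨_, ⟨N, rfl⟩, rfl⟩
      exact ⟨N, rfl⟩
    · rintro ⟨N, rfl⟩
      exact ⟨P N, ⟨N, rfl⟩, rfl⟩
  obtain ⟨μ, -, hμ⟩ := hcomp.ultrafilter_le_nhds' ((hyperfilter ℕ).map P)
    (Ultrafilter.mem_map.2 (Eventually.of_forall fun N ↦ subset_closure ⟨N, rfl⟩))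
  have hlim : Tendsto P (hyperfilter ℕ) (𝓝 μ) := hμ
  refine ⟨μ, inferInstance, fun ξ ↦ ?_, ?_⟩
  · rw [ProbabilityMeasure.tendsto_iff_forall_integral_rclike_tendsto ℂ] at hlim
    have h1 := hlim (BoundedContinuousFunction.innerProbChar ξ)
    simp_rw [← charFun_eq_integral_innerProbChar] at h1
    exact tendsto_nhds_unique h1 ((hchar ξ).mono_left Nat.hyperfilter_le_atTop)
  · exact ⟨bilateralLaplace_le_of_tendsto hlim fun N ↦
        bilateralLaplace_whithamMeasureApprox_le N (by simp),
      bilateralLaplace_le_of_tendsto hlim fun N ↦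
        bilateralLaplace_whithamMeasureApprox_le N (by simp)⟩

lemma abs_integral_mul_cos_le {f : ℝ → ℝ} (hf0 : ∀ ξ > 0, 0 ≤ f ξ)
    (hf : ∀ ξ > 0, ∃ d ≤ 0, HasDerivAt f d ξ) {x A R : ℝ} (hx : x ≠ 0) (hA : 0 < A) (hR : A ≤ R) :
    |∫ ξ in A..R, f ξ * cos (x * ξ)| ≤ 2 * f A / |x| := by
  have hpos {ξ : ℝ} (h : ξ ∈ Set.uIcc A R) : 0 < ξ := by
    rw [Set.uIcc_of_le hR] at h
    exact hA.trans_le h.1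
  have hderiv {ξ : ℝ} (h : 0 < ξ) : deriv f ξ ≤ 0 ∧ HasDerivAt f (deriv f ξ) ξ := by
    obtain ⟨d, hd, h⟩ := hf ξ h
    rw [h.deriv]
    exact ⟨hd, h⟩
  have hint : IntervalIntegrable (fun ξ ↦ deriv f ξ) volume A R := by
    have := intervalIntegral.intervalIntegrable_deriv_of_nonneg (g := fun ξ ↦ -f ξ)
      (g' := fun ξ ↦ -deriv f ξ) (a := A) (b := R)
      (fun ξ hξ ↦ (hderiv (hpos hξ)).2.neg.continuousAt.continuousWithinAt)
      (fun ξ hξ ↦ (hderiv (hpos (Set.Ioo_subset_Icc_self hξ))).2.neg)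
      (fun ξ hξ ↦ neg_nonneg.2 (hderiv (hpos (Set.Ioo_subset_Icc_self hξ))).1)
    simpa [Pi.neg_def] using this.neg
  have hibp := intervalIntegral.integral_mul_deriv_eq_deriv_mul (u := f) (u' := deriv f)
    (v := fun ξ ↦ sin (x * ξ) / x) (v' := fun ξ ↦ cos (x * ξ)) (a := A) (b := R)
    (fun ξ hξ ↦ (hderiv (hpos hξ)).2)
    (fun ξ _ ↦ by
      have := ((hasDerivAt_id ξ).const_mul x).sin.div_const x
      simpa [hx] using this)
    hint (Continuous.intervalIntegrable (by fun_prop) _ _)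
  have hsin (ξ : ℝ) : |sin (x * ξ) / x| ≤ 1 / |x| := by
    rw [abs_div]
    gcongr
    exact abs_sin_le_one _
  have hftc : ∫ ξ in A..R, deriv f ξ = f R - f A :=
    intervalIntegral.integral_eq_sub_of_hasDerivAt (fun ξ hξ ↦ (hderiv (hpos hξ)).2) hint
  have hrem : |∫ ξ in A..R, deriv f ξ * (sin (x * ξ) / x)| ≤ (f A - f R) * (1 / |x|) := by
    have h1 := intervalIntegral.norm_integral_le_of_norm_le (μ := volume) hR
      (f := fun ξ ↦ deriv f ξ * (sin (x * ξ) / x)) (g := fun ξ ↦ -deriv f ξ * (1 / |x|))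
      (.of_forall fun ξ hξ ↦ by
        rw [norm_mul, Real.norm_eq_abs, abs_of_nonpos (hderiv (hA.trans hξ.1)).1]
        gcongr
        · exact neg_nonneg.2 (hderiv (hA.trans hξ.1)).1
        · exact hsin ξ) (hint.neg.mul_const _)
    rwa [intervalIntegral.integral_mul_const, intervalIntegral.integral_neg, hftc, neg_sub] at h1
  have h1 : |f R * (sin (x * R) / x)| ≤ f R * (1 / |x|) := by
    rw [abs_mul, abs_of_nonneg (hf0 R (hA.trans_le hR))]
    exact mul_le_mul_of_nonneg_left (hsin R) (hf0 R (hA.trans_le hR))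
  have h2 : |f A * (sin (x * A) / x)| ≤ f A * (1 / |x|) := by
    rw [abs_mul, abs_of_nonneg (hf0 A hA)]
    exact mul_le_mul_of_nonneg_left (hsin A) (hf0 A hA)
  rw [hibp]
  calc _ ≤ f R * (1 / |x|) + f A * (1 / |x|) + (f A - f R) * (1 / |x|) :=
        (abs_sub _ _).trans (add_le_add ((abs_sub _ _).trans (add_le_add h1 h2)) hrem)
    _ = 2 * f A / |x| := by ring

lemma abs_sub_integral_mul_cos_le {f : ℝ → ℝ} (hc : Continuous f) (hf0 : ∀ ξ > 0, 0 ≤ f ξ)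
    (hf : ∀ ξ > 0, ∃ d ≤ 0, HasDerivAt f d ξ) {x A J : ℝ} (hx : x ≠ 0) (hA : 0 < A)
    (hJ : Tendsto (fun R ↦ ∫ ξ in (0 : ℝ)..R, f ξ * cos (x * ξ)) atTop (𝓝 J)) :
    |J - ∫ ξ in (0 : ℝ)..A, f ξ * cos (x * ξ)| ≤ 2 * f A / |x| := by
  refine le_of_tendsto (hJ.sub_const _).abs ?_
  filter_upwards [eventually_ge_atTop A] with R hR
  rw [intervalIntegral.integral_interval_sub_left
    (Continuous.intervalIntegrable (by fun_prop) _ _)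
    (Continuous.intervalIntegrable (by fun_prop) _ _)]
  exact abs_integral_mul_cos_le hf0 hf hx hA hR

lemma exists_tendsto_integral_mul_cos {f : ℝ → ℝ} (hc : Continuous f) (hf0 : ∀ ξ > 0, 0 ≤ f ξ)
    (hf : ∀ ξ > 0, ∃ d ≤ 0, HasDerivAt f d ξ) (hlim : Tendsto f atTop (𝓝 0)) {x : ℝ}
    (hx : x ≠ 0) :
    ∃ J, Tendsto (fun R ↦ ∫ ξ in (0 : ℝ)..R, f ξ * cos (x * ξ)) atTop (𝓝 J) := by
  refine cauchy_map_iff_exists_tendsto.1 (Metric.cauchy_iff.2 ⟨inferInstance, fun ε hε ↦ ?_⟩)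
  have h0 : Tendsto (fun A ↦ 2 * f A / |x|) atTop (𝓝 0) := by
    simpa using (hlim.const_mul 2).div_const |x|
  obtain ⟨A, hAε, hA⟩ := ((h0.eventually (gt_mem_nhds (half_pos hε))).and
    (eventually_gt_atTop 0)).exists
  refine ⟨_, image_mem_map (Ici_mem_atTop A), ?_⟩
  have key (R : ℝ) (hR : A ≤ R) : dist (∫ ξ in (0 : ℝ)..R, f ξ * cos (x * ξ))
      (∫ ξ in (0 : ℝ)..A, f ξ * cos (x * ξ)) < ε / 2 := by
    rw [Real.dist_eq, intervalIntegral.integral_interval_sub_left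
      (Continuous.intervalIntegrable (by fun_prop) _ _)
      (Continuous.intervalIntegrable (by fun_prop) _ _)]
    exact (abs_integral_mul_cos_le hf0 hf hx hA hR).trans_lt hAε
  rintro _ ⟨R, hR, rfl⟩ _ ⟨S, hS, rfl⟩
  linarith [dist_triangle_right (∫ ξ in (0 : ℝ)..R, f ξ * cos (x * ξ))
    (∫ ξ in (0 : ℝ)..S, f ξ * cos (x * ξ)) (∫ ξ in (0 : ℝ)..A, f ξ * cos (x * ξ)),
    key R hR, key S hS]

lemma abs_le_of_tendsto_integral_mul_cos {f : ℝ → ℝ} (hc : Continuous f)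
    (hf0 : ∀ ξ > 0, 0 ≤ f ξ) (hf : ∀ ξ > 0, ∃ d ≤ 0, HasDerivAt f d ξ)
    (hle : ∀ ξ > 0, f ξ ≤ ξ ^ (-(1 / 2) : ℝ)) {x J : ℝ} (hx : x ≠ 0)
    (hJ : Tendsto (fun R ↦ ∫ ξ in (0 : ℝ)..R, f ξ * cos (x * ξ)) atTop (𝓝 J)) :
    |J| ≤ 4 * |x| ^ (-(1 / 2) : ℝ) := by
  have hx0 : 0 < |x| := abs_pos.2 hx
  have hA : 0 < |x|⁻¹ := inv_pos.2 hx0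
  have h1 := abs_sub_integral_mul_cos_le hc hf0 hf hx hA hJ
  have hr : IntervalIntegrable (fun ξ : ℝ ↦ ξ ^ (-(1 / 2) : ℝ)) volume 0 |x|⁻¹ :=
    intervalIntegral.intervalIntegrable_rpow' (by norm_num)
  have h2 : |∫ ξ in (0 : ℝ)..|x|⁻¹, f ξ * cos (x * ξ)| ≤
      ∫ ξ in (0 : ℝ)..|x|⁻¹, ξ ^ (-(1 / 2) : ℝ) := by
    rw [← Real.norm_eq_abs]
    refine intervalIntegral.norm_integral_le_of_norm_le hA.le (.of_forall fun ξ hξ ↦ ?_) hr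
    rw [norm_mul, Real.norm_eq_abs, Real.norm_eq_abs, abs_of_nonneg (hf0 ξ hξ.1)]
    exact (mul_le_of_le_one_right (hf0 ξ hξ.1) (abs_cos_le_one _)).trans (hle ξ hξ.1)
  rw [integral_rpow (.inl (by norm_num)), Real.zero_rpow (by norm_num)] at h2
  have h3 : |x|⁻¹ ^ (-(1 / 2) + 1 : ℝ) = |x| ^ (-(1 / 2) : ℝ) := by
    rw [Real.inv_rpow hx0.le, ← Real.rpow_neg hx0.le]
    norm_num
  have h4 : 2 * f |x|⁻¹ / |x| ≤ 2 * |x| ^ (-(1 / 2) : ℝ) := by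
    rw [mul_div_assoc]
    gcongr
    refine (div_le_div_of_nonneg_right (hle _ hA) hx0.le).trans_eq ?_
    rw [Real.inv_rpow hx0.le, ← Real.rpow_neg hx0.le, ← Real.rpow_sub_one hx0.ne']
    norm_num
  rw [h3] at h2
  norm_num at h2
  rw [abs_le] at *
  constructor <;> linarith

lemma tendsto_of_tendsto_integral_mul_cos {f : ℝ → ℝ} {F : ℕ → ℝ → ℝ} (hc : Continuous f)
    (hf0 : ∀ ξ > 0, 0 ≤ f ξ) (hf : ∀ ξ > 0, ∃ d ≤ 0, HasDerivAt f d ξ)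
    (hlim : Tendsto f atTop (𝓝 0)) (hFc : ∀ n, Continuous (F n)) (hF0 : ∀ n, ∀ ξ > 0, 0 ≤ F n ξ)
    (hF : ∀ n, ∀ ξ > 0, ∃ d ≤ 0, HasDerivAt (F n) d ξ) (hle : ∀ n, ∀ ξ > 0, F n ξ ≤ f ξ)
    (hFf : ∀ ξ, Tendsto (fun n ↦ F n ξ) atTop (𝓝 (f ξ))) {x J : ℝ} {I : ℕ → ℝ} (hx : x ≠ 0)
    (hJ : Tendsto (fun R ↦ ∫ ξ in (0 : ℝ)..R, f ξ * cos (x * ξ)) atTop (𝓝 J))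
    (hI : ∀ n, Tendsto (fun R ↦ ∫ ξ in (0 : ℝ)..R, F n ξ * cos (x * ξ)) atTop (𝓝 (I n))) :
    Tendsto I atTop (𝓝 J) := by
  rw [Metric.tendsto_nhds]
  intro ε hε
  have h0 : Tendsto (fun A ↦ 2 * f A / |x|) atTop (𝓝 0) := by
    simpa using (hlim.const_mul 2).div_const |x|
  obtain ⟨A, hAε, hA⟩ := ((h0.eventually (gt_mem_nhds (show 0 < ε / 3 by positivity))).and
    (eventually_gt_atTop 0)).exists
  have hconv : Tendsto (fun n ↦ ∫ ξ in (0 : ℝ)..A, F n ξ * cos (x * ξ)) atTop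
      (𝓝 (∫ ξ in (0 : ℝ)..A, f ξ * cos (x * ξ))) := by
    refine intervalIntegral.tendsto_integral_filter_of_dominated_convergence f
      (.of_forall fun n ↦ (Continuous.aestronglyMeasurable (by fun_prop)))
      (.of_forall fun n ↦ .of_forall fun ξ hξ ↦ ?_) (hc.intervalIntegrable _ _)
      (.of_forall fun ξ _ ↦ (hFf ξ).mul_const _)
    rw [Set.uIoc_of_le hA.le] at hξ
    rw [norm_mul, Real.norm_eq_abs, Real.norm_eq_abs, abs_of_nonneg (hF0 n ξ hξ.1)]
    exact (mul_le_of_le_one_right (hF0 n ξ hξ.1) (abs_cos_le_one _)).trans (hle n ξ hξ.1)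
  filter_upwards [Metric.tendsto_nhds.1 hconv (ε / 3) (by positivity)] with n hn
  have h1 := abs_sub_integral_mul_cos_le hc hf0 hf hx hA hJ
  have h2 := abs_sub_integral_mul_cos_le (hFc n) (hF0 n) (hF n) hx hA (hI n)
  have h3 : 2 * F n A / |x| ≤ 2 * f A / |x| := by
    gcongr
    exact hle n A hA
  rw [Real.dist_eq, abs_lt] at *
  rw [abs_le] at h1 h2
  constructor <;> linarith

lemma tendsto_whithamSymbol_atTop : Tendsto whithamSymbol atTop (𝓝 0) := by
  refine squeeze_zero' (.of_forall whithamSymbol_nonneg) ?_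
    (tendsto_rpow_neg_atTop (show (0 : ℝ) < 1 / 2 by norm_num))
  filter_upwards [eventually_gt_atTop 0] with ξ hξ using whithamSymbol_le_rpow hξ

lemma tendsto_whithamKernel {x : ℝ} (hx : x ≠ 0) :
    Tendsto (fun R ↦ ∫ ξ in (0 : ℝ)..R, whithamSymbol ξ * cos (x * ξ)) atTop
      (𝓝 (π * whithamKernel x)) := by
  obtain ⟨J, hJ⟩ := exists_tendsto_integral_mul_cos continuous_whithamSymbol
    (fun ξ _ ↦ whithamSymbol_nonneg ξ) (fun ξ h ↦ exists_hasDerivAt_whithamSymbol h)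
    tendsto_whithamSymbol_atTop hx
  rw [whithamKernel, if_neg hx, (hJ.const_mul (1 / π)).limUnder_eq, ← mul_assoc,
    mul_one_div_cancel pi_ne_zero, one_mul]
  exact hJ

/-- The density of the convolution of `μ` with a centred Gaussian of variance `v`. -/
noncomputable def gaussianSmoothing (μ : Measure ℝ) (v : NNReal) (x : ℝ) : ℝ :=
  ∫ y, ProbabilityTheory.gaussianPDFReal y v x ∂μ

lemma measurable_uncurry_gaussianPDFReal (v : NNReal) :
    Measurable fun p : ℝ × ℝ ↦ ProbabilityTheory.gaussianPDFReal p.2 v p.1 := by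
  simp only [ProbabilityTheory.gaussianPDFReal]
  fun_prop

lemma integrable_gaussianPDFReal_center (μ : Measure ℝ) [IsFiniteMeasure μ] (v : NNReal) (x : ℝ) :
    Integrable (fun y ↦ ProbabilityTheory.gaussianPDFReal y v x) μ := by
  refine (integrable_const ((√(2 * π * v))⁻¹)).mono'
    ((measurable_uncurry_gaussianPDFReal v).comp measurable_prodMk_left).aestronglyMeasurable
    (.of_forall fun y ↦ ?_)
  rw [Real.norm_eq_abs, abs_of_nonneg (ProbabilityTheory.gaussianPDFReal_nonneg _ _ _),
    ProbabilityTheory.gaussianPDFReal]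
  refine mul_le_of_le_one_right (by positivity) (exp_le_one_iff.2 ?_)
  rw [neg_div]
  exact neg_nonpos.2 (by positivity)

lemma gaussianSmoothing_nonneg (μ : Measure ℝ) (v : NNReal) (x : ℝ) :
    0 ≤ gaussianSmoothing μ v x :=
  integral_nonneg fun _ ↦ ProbabilityTheory.gaussianPDFReal_nonneg _ _ _

lemma ofReal_gaussianSmoothing (μ : Measure ℝ) [IsFiniteMeasure μ] (v : NNReal) (x : ℝ) :
    ENNReal.ofReal (gaussianSmoothing μ v x) = ∫⁻ y, ProbabilityTheory.gaussianPDF y v x ∂μ :=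
  ofReal_integral_eq_lintegral_ofReal (integrable_gaussianPDFReal_center μ v x)
    (.of_forall fun _ ↦ ProbabilityTheory.gaussianPDFReal_nonneg _ _ _)

lemma measurable_gaussianSmoothing (μ : Measure ℝ) [SFinite μ] (v : NNReal) :
    Measurable (gaussianSmoothing μ v) :=
  (measurable_uncurry_gaussianPDFReal v).stronglyMeasurable.integral_prod_right.measurable

lemma lintegral_exp_mul_gaussianSmoothing (μ : Measure ℝ) [IsFiniteMeasure μ] {v : NNReal}
    (hv : v ≠ 0) (η : ℝ) :
    ∫⁻ x, ENNReal.ofReal (exp (η * x)) * ENNReal.ofReal (gaussianSmoothing μ v x) =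
      ENNReal.ofReal (exp (v * η ^ 2 / 2)) * bilateralLaplace μ η := by
  have hm : Measurable fun p : ℝ × ℝ ↦ ProbabilityTheory.gaussianPDF p.2 v p.1 :=
    (measurable_uncurry_gaussianPDFReal v).ennreal_ofReal
  have hin (y : ℝ) : ∫⁻ x, ENNReal.ofReal (exp (η * x)) * ProbabilityTheory.gaussianPDF y v x =
      ENNReal.ofReal (exp (v * η ^ 2 / 2)) * ENNReal.ofReal (exp (η * y)) := by
    have h1 := ProbabilityTheory.mgf_gaussianReal (p := ProbabilityTheory.gaussianReal y v)
      (X := id) Measure.map_id η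
    have h2 := ofReal_integral_eq_lintegral_ofReal
      (ProbabilityTheory.integrable_exp_mul_gaussianReal (μ := y) (v := v) η)
      (.of_forall fun _ ↦ (exp_pos _).le)
    simp only [ProbabilityTheory.mgf, id] at h1
    rw [h1, ProbabilityTheory.gaussianReal_of_var_ne_zero _ hv,
      lintegral_withDensity_eq_lintegral_mul
      _ (ProbabilityTheory.measurable_gaussianPDF y v) (by fun_prop)] at h2
    rw [← ENNReal.ofReal_mul (exp_pos _).le, ← exp_add, add_comm (_ / 2), mul_comm η, h2]
    exact lintegral_congr fun x ↦ mul_comm _ _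
  have hmy (x : ℝ) : Measurable fun y ↦ ProbabilityTheory.gaussianPDF y v x := by
    simp only [ProbabilityTheory.gaussianPDF, ProbabilityTheory.gaussianPDFReal]
    fun_prop
  simp_rw [ofReal_gaussianSmoothing]
  calc _ = ∫⁻ x, ∫⁻ y, ENNReal.ofReal (exp (η * x)) * ProbabilityTheory.gaussianPDF y v x ∂μ := by
        refine lintegral_congr fun x ↦ ?_
        rw [lintegral_const_mul _ (hmy x)]
    _ = ∫⁻ y, (∫⁻ x, ENNReal.ofReal (exp (η * x)) * ProbabilityTheory.gaussianPDF y v x) ∂μ := by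
        refine lintegral_lintegral_swap (Measurable.aemeasurable ?_)
        exact Measurable.mul (by fun_prop) hm
    _ = _ := by
        simp_rw [hin]
        rw [lintegral_const_mul _ (by fun_prop), bilateralLaplace]

lemma gaussianSmoothing_eq_integral (μ : Measure ℝ) [IsFiniteMeasure μ] {v : NNReal} (hv : v ≠ 0)
    {m : ℝ → ℝ} (hm : ∀ ξ, charFun μ ξ = m ξ) (x : ℝ) :
    2 * π * gaussianSmoothing μ v x = ∫ ξ, exp (-v * ξ ^ 2 / 2) * m ξ * cos (x * ξ) := by
  have hv0 : (0 : ℝ) < v := by exact_mod_cast pos_iff_ne_zero.2 hv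
  have hswap : ∫ ξ, charFun μ ξ * Complex.exp (-(x * ξ) * Complex.I)
      ∂ProbabilityTheory.gaussianReal 0 v⁻¹ =
      ∫ y, charFun (ProbabilityTheory.gaussianReal 0 v⁻¹) (y - x) ∂μ := by
    simp_rw [charFun_apply_real, ← integral_mul_const, ← Complex.exp_add]
    rw [integral_integral_swap]
    · refine integral_congr_ae (.of_forall fun y ↦ integral_congr_ae (.of_forall fun ξ ↦ ?_))
      simp only
      congr 1
      push_cast
      ring
    · refine (integrable_const (1 : ℝ)).mono' (by fun_prop) (.of_forall fun p ↦ ?_)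
      simp only [Function.uncurry]
      rw [← Complex.ofReal_mul, ← Complex.ofReal_mul, ← Complex.ofReal_neg, ← add_mul,
        ← Complex.ofReal_add, Complex.norm_exp_ofReal_mul_I]
  have hr : ∫ y, charFun (ProbabilityTheory.gaussianReal 0 v⁻¹) (y - x) ∂μ =
      ((√(2 * π * v) * gaussianSmoothing μ v x : ℝ) : ℂ) := by
    rw [gaussianSmoothing, ← integral_const_mul, ← integral_complex_ofReal]
    refine integral_congr_ae (.of_forall fun y ↦ ?_)
    simp only
    rw [ProbabilityTheory.charFun_gaussianReal, ProbabilityTheory.gaussianPDFReal, ← mul_assoc,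
      mul_inv_cancel₀ (by positivity), one_mul, Complex.ofReal_exp]
    congr 1
    push_cast
    have : (v : ℂ) ≠ 0 := by exact_mod_cast hv
    field_simp
    ring
  rw [hr] at hswap
  have hi : Integrable (fun ξ : ℝ ↦ charFun μ ξ * Complex.exp (-(x * ξ) * Complex.I))
      (ProbabilityTheory.gaussianReal 0 v⁻¹) := by
    refine (integrable_const (μ.real Set.univ)).mono'
      (measurable_charFun.mul (by fun_prop)).aestronglyMeasurable (.of_forall fun ξ ↦ ?_)
    rw [norm_mul, ← Complex.ofReal_mul, ← Complex.ofReal_neg, Complex.norm_exp_ofReal_mul_I,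
      mul_one]
    exact norm_charFun_le ξ
  have hre := congrArg Complex.re hswap
  have hpt (ξ : ℝ) : (charFun μ ξ * Complex.exp (-(x * ξ) * Complex.I)).re =
      m ξ * cos (x * ξ) := by
    rw [hm, Complex.re_ofReal_mul, ← Complex.ofReal_mul, ← Complex.ofReal_neg,
      Complex.exp_ofReal_mul_I_re, cos_neg]
  rw [Complex.ofReal_re, ← RCLike.re_eq_complex_re, ← integral_re hi] at hre
  simp only [RCLike.re_eq_complex_re, hpt] at hre
  rw [ProbabilityTheory.integral_gaussianReal_eq_integral_smul (inv_ne_zero hv)] at hre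
  have hs : √(2 * π * v) * √(2 * π * (v : ℝ)⁻¹) = 2 * π := by
    rw [← Real.sqrt_mul (by positivity), show 2 * π * v * (2 * π * (v : ℝ)⁻¹) = (2 * π) ^ 2 by
      field_simp, Real.sqrt_sq (by positivity)]
  rw [← hs, mul_right_comm, ← hre, mul_comm, ← integral_const_mul]
  refine integral_congr_ae (.of_forall fun ξ ↦ ?_)
  simp only [ProbabilityTheory.gaussianPDFReal, smul_eq_mul, NNReal.coe_inv, sub_zero]
  rw [← mul_assoc, mul_inv_cancel_left₀ (by positivity)]
  rw [mul_assoc (exp _)]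
  congr 2
  field_simp

lemma integrable_exp_mul_whithamSymbol {v : ℝ} (hv : 0 < v) :
    Integrable fun ξ ↦ exp (-v * ξ ^ 2 / 2) * whithamSymbol ξ := by
  refine (integrable_exp_neg_mul_sq (half_pos hv)).mono'
    (Continuous.aestronglyMeasurable (by have := continuous_whithamSymbol; fun_prop))
    (.of_forall fun ξ ↦ ?_)
  rw [norm_mul, Real.norm_eq_abs, Real.norm_eq_abs, abs_of_nonneg (exp_pos _).le,
    abs_of_nonneg (whithamSymbol_nonneg ξ), mul_div_right_comm, neg_div]
  exact mul_le_of_le_one_right (exp_pos _).le (whithamSymbol_le_one ξ)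

lemma tendsto_gaussianSmoothing {μ : Measure ℝ} [IsFiniteMeasure μ]
    (hμ : ∀ ξ, charFun μ ξ = whithamSymbol ξ) {v : NNReal} (hv : v ≠ 0) (x : ℝ) :
    Tendsto (fun R ↦ ∫ ξ in (0 : ℝ)..R, exp (-v * ξ ^ 2 / 2) * whithamSymbol ξ * cos (x * ξ)) atTop
      (𝓝 (π * gaussianSmoothing μ v x)) := by
  have hv0 : (0 : ℝ) < v := by exact_mod_cast pos_iff_ne_zero.2 hv
  have hi : Integrable fun ξ ↦ exp (-v * ξ ^ 2 / 2) * whithamSymbol ξ * cos (x * ξ) := by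
    refine (integrable_exp_mul_whithamSymbol hv0).mul_bdd (c := 1)
      (by fun_prop) ?_
    exact .of_forall fun ξ ↦ abs_cos_le_one _
  have h1 := intervalIntegral_tendsto_integral_Ioi 0 hi.integrableOn tendsto_id
  have h2 := gaussianSmoothing_eq_integral μ hv hμ x
  have h3 := integral_comp_abs
    (f := fun ξ ↦ exp (-v * ξ ^ 2 / 2) * whithamSymbol ξ * cos (x * ξ))
  have h4 (ξ : ℝ) : exp (-v * |ξ| ^ 2 / 2) * whithamSymbol |ξ| * cos (x * |ξ|) =
      exp (-v * ξ ^ 2 / 2) * whithamSymbol ξ * cos (x * ξ) := by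
    rcases abs_choice ξ with h | h <;> simp [h, whithamSymbol_neg]
  simp only [h4] at h3
  rw [h3, mul_assoc] at h2
  rwa [mul_left_cancel₀ two_ne_zero h2]

lemma exists_hasDerivAt_exp_mul_whithamSymbol {v : ℝ} (hv : 0 ≤ v) {ξ : ℝ} (h : 0 < ξ) :
    ∃ d ≤ 0, HasDerivAt (fun ξ ↦ exp (-v * ξ ^ 2 / 2) * whithamSymbol ξ) d ξ := by
  obtain ⟨d, hd, hm⟩ := exists_hasDerivAt_whithamSymbol h
  have he : HasDerivAt (fun ξ ↦ exp (-v * ξ ^ 2 / 2)) (exp (-v * ξ ^ 2 / 2) * (-v * ξ)) ξ := by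
    convert (((hasDerivAt_pow 2 ξ).const_mul (-v)).div_const 2).exp using 1
    push_cast
    ring
  refine ⟨_, ?_, he.mul hm⟩
  have h1 : 0 ≤ exp (-v * ξ ^ 2 / 2) * (v * ξ) * whithamSymbol ξ :=
    mul_nonneg (by positivity) (whithamSymbol_nonneg ξ)
  have h2 : exp (-v * ξ ^ 2 / 2) * d ≤ 0 := mul_nonpos_of_nonneg_of_nonpos (exp_pos _).le hd
  linarith

lemma exp_mul_whithamSymbol_le {v : ℝ} (hv : 0 ≤ v) (ξ : ℝ) :
    exp (-v * ξ ^ 2 / 2) * whithamSymbol ξ ≤ whithamSymbol ξ := by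
  refine mul_le_of_le_one_left (whithamSymbol_nonneg ξ) (exp_le_one_iff.2 ?_)
  rw [neg_mul, neg_div]
  exact neg_nonpos.2 (by positivity)

/-- The Whitham kernel is an almost everywhere limit of nonnegative kernels of unit mass with
uniformly bounded exponential moments. -/
theorem exists_seq_tendsto_whithamKernel :
    ∃ k : ℕ → ℝ → ℝ, (∀ n, Measurable (k n)) ∧ (∀ n x, 0 ≤ k n x) ∧
      (∀ n x, x ≠ 0 → k n x ≤ 2 * |x| ^ (-(1 / 2) : ℝ)) ∧
      (∀ n, ∫⁻ x, ENNReal.ofReal (k n x) = 1) ∧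
      (∀ n, ∫⁻ x, ENNReal.ofReal (exp |x|) * ENNReal.ofReal (k n x) ≤ 8) ∧
      ∀ x, x ≠ 0 → Tendsto (fun n ↦ k n x) atTop (𝓝 (whithamKernel x)) := by
  obtain ⟨μ, hprob, hμ, hp, hn⟩ := exists_measure_charFun_eq_whithamSymbol
  have hc := continuous_whithamSymbol
  let v (n : ℕ) : NNReal := 1 / (n + 1)
  have hv (n : ℕ) : v n ≠ 0 := by positivity
  have hvlim : Tendsto (fun n ↦ (v n : ℝ)) atTop (𝓝 0) := by
    simpa [v] using tendsto_one_div_add_atTop_nhds_zero_nat (𝕜 := ℝ)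
  have hv1 (n : ℕ) : (v n : ℝ) ≤ 1 := by
    simp only [v]
    push_cast
    rw [div_le_one (by positivity)]
    linarith [n.cast_nonneg (α := ℝ)]
  refine ⟨fun n ↦ gaussianSmoothing μ (v n), fun n ↦ measurable_gaussianSmoothing μ (v n),
    fun n x ↦ gaussianSmoothing_nonneg μ (v n) x, fun n x hx ↦ ?_, fun n ↦ ?_, fun n ↦ ?_,
    fun x hx ↦ ?_⟩
  · have h1 := abs_le_of_tendsto_integral_mul_cos (by fun_prop)
      (fun ξ _ ↦ mul_nonneg (exp_pos _).le (whithamSymbol_nonneg ξ))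
      (fun ξ hξ ↦ exists_hasDerivAt_exp_mul_whithamSymbol (v n).2 hξ)
      (fun ξ hξ ↦ (exp_mul_whithamSymbol_le (v n).2 ξ).trans (whithamSymbol_le_rpow hξ)) hx
      (tendsto_gaussianSmoothing hμ (hv n) x)
    have h2 := gaussianSmoothing_nonneg μ (v n) x
    have h3 : 0 ≤ |x| ^ (-(1 / 2) : ℝ) := by positivity
    rw [abs_of_nonneg (by positivity)] at h1
    nlinarith [pi_gt_three]
  · simpa [bilateralLaplace_zero] using lintegral_exp_mul_gaussianSmoothing μ (hv n) 0
  · have hE : ENNReal.ofReal (exp (v n * 1 / 2)) ≤ 2 := by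
      rw [← ENNReal.ofReal_ofNat]
      refine ENNReal.ofReal_le_ofReal ?_
      calc exp (v n * 1 / 2) ≤ exp (log 2) := exp_le_exp.2 (by linarith [hv1 n, log_two_gt_d9])
        _ = 2 := exp_log two_pos
    have h1 := lintegral_exp_mul_gaussianSmoothing μ (hv n) 1
    have h2 := lintegral_exp_mul_gaussianSmoothing μ (hv n) (-1)
    simp only [one_mul, neg_mul, one_pow, even_two, Even.neg_pow] at h1 h2
    calc _ ≤ ∫⁻ x, (ENNReal.ofReal (exp x) * ENNReal.ofReal (gaussianSmoothing μ (v n) x) +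
          ENNReal.ofReal (exp (-x)) * ENNReal.ofReal (gaussianSmoothing μ (v n) x)) := by
          refine lintegral_mono fun x ↦ ?_
          rw [← add_mul, ← ENNReal.ofReal_add (exp_pos _).le (exp_pos _).le]
          gcongr
          rcases abs_choice x with h | h <;> rw [h] <;> linarith [exp_pos x, exp_pos (-x)]
      _ ≤ 2 * 2 + 2 * 2 := by
          have hm := measurable_gaussianSmoothing μ (v n)
          rw [lintegral_add_left (by fun_prop), h1, h2]
          gcongr
      _ = 8 := by norm_num
  · have h := tendsto_of_tendsto_integral_mul_cos
      (F := fun n ξ ↦ exp (-(v n) * ξ ^ 2 / 2) * whithamSymbol ξ)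
      (I := fun n ↦ π * gaussianSmoothing μ (v n) x) hc
      (fun ξ _ ↦ whithamSymbol_nonneg ξ) (fun ξ h ↦ exists_hasDerivAt_whithamSymbol h)
      tendsto_whithamSymbol_atTop (fun n ↦ by fun_prop)
      (fun n ξ _ ↦ mul_nonneg (exp_pos _).le (whithamSymbol_nonneg ξ))
      (fun n ξ hξ ↦ exists_hasDerivAt_exp_mul_whithamSymbol (v n).2 hξ)
      (fun n ξ _ ↦ exp_mul_whithamSymbol_le (v n).2 ξ)
      (fun ξ ↦ by
        have : Tendsto (fun n ↦ exp (-(v n) * ξ ^ 2 / 2)) atTop (𝓝 (exp (-0 * ξ ^ 2 / 2))) :=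
          (continuous_exp.tendsto _).comp ((hvlim.neg.mul_const _).div_const _)
        simpa using this.mul_const (whithamSymbol ξ))
      hx (tendsto_whithamKernel hx) (fun n ↦ tendsto_gaussianSmoothing hμ (hv n) x)
    simpa [inv_mul_cancel_left₀ pi_ne_zero] using h.const_mul π⁻¹

lemma integrableOn_abs_rpow {M : ℝ} (hM : 0 ≤ M) :
    IntegrableOn (fun x : ℝ ↦ |x| ^ (-(1 / 2) : ℝ)) (Set.Icc (-M) M) := by
  have h1 : IntervalIntegrable (fun x : ℝ ↦ |x| ^ (-(1 / 2) : ℝ)) volume 0 M := by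
    have h : IntervalIntegrable (fun x : ℝ ↦ x ^ (-(1 / 2) : ℝ)) volume 0 M :=
      intervalIntegral.intervalIntegrable_rpow' (by norm_num)
    refine h.congr fun x hx ↦ ?_
    rw [Set.uIoc_of_le hM] at hx
    simp only [abs_of_pos hx.1]
  have h2 := h1.comp_sub_left 0
  simp only [sub_zero, zero_sub, abs_neg] at h2
  rw [integrableOn_Icc_iff_integrableOn_Ioc, ← intervalIntegrable_iff_integrableOn_Ioc_of_le
    (by linarith)]
  exact h2.symm.trans h1

lemma ae_ne_zero : ∀ᵐ x : ℝ, x ≠ 0 := Measure.ae_ne volume 0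

lemma whithamKernel_nonneg (x : ℝ) : 0 ≤ whithamKernel x := by
  obtain ⟨k, -, h0, -, -, -, hk⟩ := exists_seq_tendsto_whithamKernel
  rcases eq_or_ne x 0 with rfl | hx
  · simp [whithamKernel]
  · exact ge_of_tendsto' (hk x hx) fun n ↦ h0 n x

lemma aemeasurable_whithamKernel : AEMeasurable whithamKernel := by
  obtain ⟨k, hm, -, -, -, -, hk⟩ := exists_seq_tendsto_whithamKernel
  exact aemeasurable_of_tendsto_metrizable_ae atTop (fun n ↦ (hm n).aemeasurable)
    (ae_ne_zero.mono hk)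

lemma lintegral_exp_abs_mul_whithamKernel_le :
    ∫⁻ x, ENNReal.ofReal (exp |x|) * ENNReal.ofReal (whithamKernel x) ≤ 8 := by
  obtain ⟨k, hm, -, -, -, h8, hk⟩ := exists_seq_tendsto_whithamKernel
  calc _ = ∫⁻ x, liminf (fun n ↦ ENNReal.ofReal (exp |x|) * ENNReal.ofReal (k n x)) atTop := by
        refine lintegral_congr_ae (ae_ne_zero.mono fun x hx ↦ ?_)
        exact (ENNReal.Tendsto.const_mul (ENNReal.tendsto_ofReal (hk x hx))
          (.inr ENNReal.ofReal_ne_top)).liminf_eq.symm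
    _ ≤ liminf (fun n ↦ ∫⁻ x, ENNReal.ofReal (exp |x|) * ENNReal.ofReal (k n x)) atTop :=
        lintegral_liminf_le fun n ↦ Measurable.mul (by fun_prop) (hm n).ennreal_ofReal
    _ ≤ 8 := liminf_le_of_le (by isBoundedDefault) fun b hb ↦ by
        obtain ⟨n, hn⟩ := hb.exists
        exact hn.trans (h8 n)

lemma lintegral_whithamKernel : ∫⁻ x, ENNReal.ofReal (whithamKernel x) = 1 := by
  obtain ⟨k, hm, h0, hle, h1, h8, hk⟩ := exists_seq_tendsto_whithamKernel
  apply le_antisymm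
  · calc _ = ∫⁻ x, liminf (fun n ↦ ENNReal.ofReal (k n x)) atTop :=
          lintegral_congr_ae (ae_ne_zero.mono fun x hx ↦
            (ENNReal.tendsto_ofReal (hk x hx)).liminf_eq.symm)
      _ ≤ liminf (fun n ↦ ∫⁻ x, ENNReal.ofReal (k n x)) atTop :=
          lintegral_liminf_le fun n ↦ (hm n).ennreal_ofReal
      _ = 1 := by simp [h1]
  have key : ∀ᶠ M : ℝ in atTop,
      1 ≤ (∫⁻ x, ENNReal.ofReal (whithamKernel x)) + ENNReal.ofReal (exp (-M)) * 8 := by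
    filter_upwards [eventually_ge_atTop 0] with M hM
    have htail (n : ℕ) : ∫⁻ x in (Set.Icc (-M) M)ᶜ, ENNReal.ofReal (k n x) ≤
        ENNReal.ofReal (exp (-M)) * 8 := by
      calc _ ≤ ∫⁻ x in (Set.Icc (-M) M)ᶜ, ENNReal.ofReal (exp (-M)) *
            (ENNReal.ofReal (exp |x|) * ENNReal.ofReal (k n x)) := by
            refine setLIntegral_mono' measurableSet_Icc.compl fun x hx ↦ ?_
            rw [← mul_assoc, ← ENNReal.ofReal_mul (exp_pos _).le, ← exp_add]
            refine le_mul_of_one_le_left zero_le (ENNReal.one_le_ofReal.2 (one_le_exp ?_))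
            rw [Set.mem_compl_iff, Set.mem_Icc, ← abs_le] at hx
            linarith
        _ ≤ ∫⁻ x, ENNReal.ofReal (exp (-M)) *
            (ENNReal.ofReal (exp |x|) * ENNReal.ofReal (k n x)) := setLIntegral_le_lintegral _ _
        _ ≤ _ := by
            rw [lintegral_const_mul' _ _ ENNReal.ofReal_ne_top]
            gcongr
            exact h8 n
    have hbd : ∫⁻ x in Set.Icc (-M) M, ENNReal.ofReal (2 * |x| ^ (-(1 / 2) : ℝ)) ≠ ⊤ :=
      ((integrableOn_abs_rpow hM).const_mul 2).lintegral_lt_top.ne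
    have hlim := tendsto_lintegral_of_dominated_convergence _
      (fun n ↦ (hm n).ennreal_ofReal)
      (fun n ↦ ae_restrict_of_ae (ae_ne_zero.mono fun x hx ↦ ENNReal.ofReal_le_ofReal (hle n x hx)))
      hbd (ae_restrict_of_ae (ae_ne_zero.mono fun x hx ↦ ENNReal.tendsto_ofReal (hk x hx)))
    refine (ge_of_tendsto' (hlim.add_const (ENNReal.ofReal (exp (-M)) * 8)) fun n ↦ ?_).trans
      (add_le_add_left (setLIntegral_le_lintegral _ _) _)
    rw [← h1 n, ← lintegral_add_compl _ (measurableSet_Icc (a := -M) (b := M))]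
    gcongr
    exact htail n
  have hlim : Tendsto (fun M ↦ (∫⁻ x, ENNReal.ofReal (whithamKernel x)) +
      ENNReal.ofReal (exp (-M)) * 8) atTop (𝓝 (∫⁻ x, ENNReal.ofReal (whithamKernel x))) := by
    have h : Tendsto (fun M ↦ ENNReal.ofReal (exp (-M)) * 8) atTop (𝓝 0) := by
      have := ENNReal.Tendsto.mul_const (b := 8)
        (ENNReal.tendsto_ofReal tendsto_exp_neg_atTop_nhds_zero)
        (.inr (by simp))
      simpa using this
    simpa using h.const_add (∫⁻ x, ENNReal.ofReal (whithamKernel x))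
  exact ge_of_tendsto hlim key

lemma integrable_exp_abs_mul_whithamKernel : Integrable fun x ↦ exp |x| * whithamKernel x := by
  have hm := aemeasurable_whithamKernel
  refine ⟨AEMeasurable.aestronglyMeasurable (by fun_prop), ?_⟩
  rw [hasFiniteIntegral_iff_ofReal
    (.of_forall fun x ↦ mul_nonneg (exp_pos _).le (whithamKernel_nonneg x))]
  simp_rw [ENNReal.ofReal_mul (exp_pos _).le]
  exact lintegral_exp_abs_mul_whithamKernel_le.trans_lt (by simp)

lemma integrable_exp_mul_abs_mul_whithamKernel {η : ℝ} (hη : η ≤ 1) :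
    Integrable fun x ↦ exp (η * |x|) * whithamKernel x := by
  have hm := aemeasurable_whithamKernel
  refine integrable_exp_abs_mul_whithamKernel.mono' (AEMeasurable.aestronglyMeasurable
    (by fun_prop)) (.of_forall fun x ↦ ?_)
  rw [norm_mul, Real.norm_eq_abs, Real.norm_eq_abs, abs_of_nonneg (exp_pos _).le,
    abs_of_nonneg (whithamKernel_nonneg x)]
  gcongr
  · exact whithamKernel_nonneg x
  · exact mul_le_of_le_one_left (abs_nonneg x) hη

lemma integrable_whithamKernel : Integrable whithamKernel := by
  simpa using integrable_exp_mul_abs_mul_whithamKernel (η := 0) zero_le_one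

lemma integral_whithamKernel : ∫ x, whithamKernel x = 1 := by
  rw [integral_eq_lintegral_of_nonneg_ae (.of_forall whithamKernel_nonneg)
    integrable_whithamKernel.1, lintegral_whithamKernel, ENNReal.toReal_one]

lemma integrable_whithamKernel_mul_abs : Integrable fun x ↦ whithamKernel x * |x| := by
  have hm := aemeasurable_whithamKernel
  refine integrable_exp_abs_mul_whithamKernel.mono' (AEMeasurable.aestronglyMeasurable
    (by fun_prop)) (.of_forall fun x ↦ ?_)
  rw [norm_mul, Real.norm_eq_abs, Real.norm_eq_abs, abs_abs,
    abs_of_nonneg (whithamKernel_nonneg x), mul_comm]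
  gcongr
  · exact whithamKernel_nonneg x
  · linarith [add_one_le_exp |x|]

lemma lop_eq_integral (K f : ℝ → ℝ) (x : ℝ) : Lop K f x = ∫ z, K z * f (x - z) := by
  rw [Lop, ← integral_sub_left_eq_self _ volume x]
  simp

lemma integrable_whithamKernel_mul {f : ℝ → ℝ} (hf : Continuous f) {C : ℝ}
    (hC : ∀ x, |f x| ≤ C) (x : ℝ) : Integrable fun z ↦ whithamKernel z * f (x - z) :=
  integrable_whithamKernel.mul_bdd (c := C) (Continuous.aestronglyMeasurable (by fun_prop))
    (.of_forall fun z ↦ hC _)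

lemma lop_whithamKernel_add_const {f : ℝ → ℝ} (hf : Continuous f) {C : ℝ}
    (hC : ∀ x, |f x| ≤ C) (c x : ℝ) :
    Lop whithamKernel (fun y ↦ f y + c) x = Lop whithamKernel f x + c := by
  simp_rw [lop_eq_integral, mul_add]
  rw [integral_add (integrable_whithamKernel_mul hf hC x) (integrable_whithamKernel.mul_const c),
    integral_mul_const, integral_whithamKernel, one_mul]

lemma tendsto_lop_whithamKernel {f : ℝ → ℝ} (hf : Continuous f) {C : ℝ} (hC : ∀ x, |f x| ≤ C)
    {c : ℝ} (hlim : Tendsto f atTop (𝓝 c)) :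
    Tendsto (Lop whithamKernel f) atTop (𝓝 c) := by
  have h : Tendsto (fun x ↦ ∫ z, whithamKernel z * f (x - z)) atTop
      (𝓝 (∫ z, whithamKernel z * c)) := by
    refine tendsto_integral_filter_of_dominated_convergence (fun z ↦ whithamKernel z * C)
      (.of_forall fun x ↦ (integrable_whithamKernel_mul hf hC x).1)
      (.of_forall fun x ↦ .of_forall fun z ↦ ?_) (integrable_whithamKernel.mul_const C)
      (.of_forall fun z ↦ ?_)
    · rw [norm_mul, Real.norm_eq_abs, abs_of_nonneg (whithamKernel_nonneg z)]
      exact mul_le_mul_of_nonneg_left (hC _) (whithamKernel_nonneg z)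
    · exact (hlim.comp (tendsto_atTop_add_const_right atTop (-z) tendsto_id)).const_mul _
  rw [integral_mul_const, integral_whithamKernel, one_mul] at h
  exact h.congr fun x ↦ (lop_eq_integral _ _ x).symm

lemma tendsto_integral_window {f : ℝ → ℝ} (hf : Continuous f) {C : ℝ} (hC : ∀ x, |f x| ≤ C)
    {l : Filter ℝ} [l.IsCountablyGenerated] {g : ℝ → ℝ}
    (hlim : ∀ t, Tendsto (fun R ↦ f (g R + t)) l (𝓝 0)) (z : ℝ) :
    Tendsto (fun R ↦ ∫ x in g R..g R - z, f x) l (𝓝 0) := by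
  have h : Tendsto (fun R ↦ ∫ t in (0 : ℝ)..-z, f (g R + t)) l (𝓝 (∫ t in (0 : ℝ)..-z, 0)) :=
    intervalIntegral.tendsto_integral_filter_of_dominated_convergence (fun _ ↦ C)
      (.of_forall fun R ↦ Continuous.aestronglyMeasurable (by fun_prop))
      (.of_forall fun R ↦ .of_forall fun t _ ↦ hC _) intervalIntegrable_const
      (.of_forall fun t _ ↦ hlim t)
  simpa [intervalIntegral.integral_comp_add_left, ← sub_eq_add_neg] using h

lemma integral_sub_lop_whithamKernel {f : ℝ → ℝ} (hf : Continuous f) {C : ℝ}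
    (hC : ∀ x, |f x| ≤ C) (a b : ℝ) :
    ∫ x in a..b, (f x - Lop whithamKernel f x) =
      ∫ z, whithamKernel z * ((∫ x in a..a - z, f x) - ∫ x in b..b - z, f x) := by
  have h1 (x : ℝ) : f x - Lop whithamKernel f x = ∫ z, whithamKernel z * (f x - f (x - z)) := by
    simp_rw [lop_eq_integral, mul_sub]
    rw [integral_sub (integrable_whithamKernel.mul_const _) (integrable_whithamKernel_mul hf hC x),
      integral_mul_const, integral_whithamKernel, one_mul]
  simp_rw [h1]
  rw [intervalIntegral_integral_swap]
  · refine integral_congr_ae (.of_forall fun z ↦ ?_)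
    simp only
    rw [intervalIntegral.integral_const_mul, intervalIntegral.integral_sub
      (Continuous.intervalIntegrable (by fun_prop) _ _)
      (Continuous.intervalIntegrable (by fun_prop) _ _), intervalIntegral.integral_comp_sub_right,
      intervalIntegral.integral_interval_sub_interval_comm
        (Continuous.intervalIntegrable (by fun_prop) _ _)
        (Continuous.intervalIntegrable (by fun_prop) _ _)
        (Continuous.intervalIntegrable (by fun_prop) _ _)]
  · have : IsFiniteMeasure (volume.restrict (Set.uIoc a b)) := by
      rw [Set.uIoc]; infer_instance
    have h := ((integrable_const (μ := volume.restrict (Set.uIoc a b)) (1 : ℝ)).mul_prod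
      integrable_whithamKernel).mul_bdd (c := 2 * C) (g := fun p : ℝ × ℝ ↦ f p.1 - f (p.1 - p.2))
      (Continuous.aestronglyMeasurable (by fun_prop)) (.of_forall fun p ↦ ?_)
    · simpa [Function.uncurry_def] using h
    · rw [two_mul]
      exact (norm_sub_le _ _).trans (add_le_add (hC _) (hC _))

lemma continuous_lop_whithamKernel {f : ℝ → ℝ} (hf : Continuous f) {C : ℝ}
    (hC : ∀ x, |f x| ≤ C) : Continuous (Lop whithamKernel f) := by
  simp_rw [funext (lop_eq_integral whithamKernel f)]
  refine continuous_of_dominated (bound := fun z ↦ whithamKernel z * C)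
    (fun x ↦ (integrable_whithamKernel_mul hf hC x).1) (fun x ↦ .of_forall fun z ↦ ?_)
    (integrable_whithamKernel.mul_const C) (.of_forall fun z ↦ by fun_prop)
  rw [norm_mul, Real.norm_eq_abs, abs_of_nonneg (whithamKernel_nonneg z)]
  exact mul_le_mul_of_nonneg_left (hC _) (whithamKernel_nonneg z)

lemma continuous_integral_window {f : ℝ → ℝ} (hf : Continuous f) (a : ℝ) :
    Continuous fun z ↦ ∫ x in a..a - z, f x :=
  (intervalIntegral.continuous_primitive (fun _ _ ↦ hf.intervalIntegrable _ _) a).comp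
    (continuous_const.sub continuous_id)

lemma abs_integral_window_le {f : ℝ → ℝ} {C : ℝ} (hC : ∀ x, |f x| ≤ C) (a z : ℝ) :
    |∫ x in a..a - z, f x| ≤ C * |z| := by
  simpa using intervalIntegral.norm_integral_le_of_norm_le_const (a := a) (b := a - z)
    (f := f) (C := C) fun x _ ↦ hC x

lemma eq_zero_of_sq_le_sub_lop {f : ℝ → ℝ} (hf : Continuous f) {C : ℝ} (hC : ∀ x, |f x| ≤ C)
    (htop : Tendsto f atTop (𝓝 0)) (hbot : Tendsto f atBot (𝓝 0))
    (hsq : ∀ x, f x ^ 2 ≤ f x - Lop whithamKernel f x) (x : ℝ) : f x = 0 := by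
  have hlim : Tendsto (fun R ↦ ∫ x in -R..R, (f x - Lop whithamKernel f x)) atTop (𝓝 0) := by
    simp_rw [integral_sub_lop_whithamKernel hf hC]
    have hw (z : ℝ) : Tendsto (fun R ↦ whithamKernel z *
        ((∫ x in -R..-R - z, f x) - ∫ x in R..R - z, f x)) atTop (𝓝 0) := by
      have h1 := tendsto_integral_window hf hC (l := atTop) (g := fun R ↦ -R) (fun t ↦
        hbot.comp (tendsto_atBot_add_const_right atTop t tendsto_neg_atTop_atBot)) z
      have h2 := tendsto_integral_window hf hC (l := atTop) (g := fun R ↦ R) (fun t ↦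
        htop.comp (tendsto_atTop_add_const_right atTop t tendsto_id)) z
      simpa using (h1.sub h2).const_mul (whithamKernel z)
    have h := tendsto_integral_filter_of_dominated_convergence
      (fun z ↦ 2 * C * (whithamKernel z * |z|))
      (.of_forall fun R ↦ integrable_whithamKernel.1.mul
        ((continuous_integral_window hf (-R)).sub
          (continuous_integral_window hf R)).aestronglyMeasurable)
      (.of_forall fun R ↦ .of_forall fun z ↦ ?_) (integrable_whithamKernel_mul_abs.const_mul _)
      (.of_forall hw)
    · simpa using h
    · rw [Pi.mul_apply, norm_mul, Real.norm_eq_abs, abs_of_nonneg (whithamKernel_nonneg z)]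
      calc _ ≤ whithamKernel z * (C * |z| + C * |z|) :=
            mul_le_mul_of_nonneg_left ((norm_sub_le _ _).trans (add_le_add
              (abs_integral_window_le hC _ _) (abs_integral_window_le hC _ _)))
              (whithamKernel_nonneg z)
        _ = _ := by ring
  by_contra hx
  have hpos : 0 < ∫ t in -(|x| + 1)..|x| + 1, f t ^ 2 := by
    refine intervalIntegral.integral_pos (by linarith [abs_nonneg x]) (by fun_prop)
      (fun _ _ ↦ sq_nonneg _) ⟨x, ⟨by linarith [neg_abs_le x], by linarith [le_abs_self x]⟩,
        by positivity⟩
  refine hpos.not_ge (ge_of_tendsto hlim ?_)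
  filter_upwards [eventually_ge_atTop (|x| + 1)] with R hR
  have hcont := continuous_lop_whithamKernel hf hC
  calc ∫ t in -(|x| + 1)..|x| + 1, f t ^ 2 ≤ ∫ t in -R..R, f t ^ 2 :=
        intervalIntegral.integral_mono_interval (by linarith) (by linarith [abs_nonneg x]) hR
          (.of_forall fun t ↦ sq_nonneg _) (Continuous.intervalIntegrable (by fun_prop) _ _)
    _ ≤ _ := intervalIntegral.integral_mono_on (by linarith [abs_nonneg x])
        (Continuous.intervalIntegrable (by fun_prop) _ _)
        (Continuous.intervalIntegrable (by fun_prop) _ _) fun t _ ↦ hsq t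

lemma tendsto_integral_exp_mul_abs_mul_whithamKernel :
    Tendsto (fun η ↦ ∫ x, exp (η * |x|) * whithamKernel x) (𝓝[>] 0) (𝓝 1) := by
  have h1 : ∀ᶠ η : ℝ in 𝓝[>] 0, η ≤ 1 :=
    nhdsWithin_le_nhds (eventually_le_nhds zero_lt_one)
  rw [← integral_whithamKernel]
  refine tendsto_integral_filter_of_dominated_convergence (fun x ↦ exp |x| * whithamKernel x)
    (h1.mono fun η hη ↦ (integrable_exp_mul_abs_mul_whithamKernel hη).1)
    (h1.mono fun η hη ↦ .of_forall fun x ↦ ?_) integrable_exp_abs_mul_whithamKernel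
    (.of_forall fun x ↦ ?_)
  · rw [norm_mul, Real.norm_eq_abs, Real.norm_eq_abs, abs_of_nonneg (exp_pos _).le,
      abs_of_nonneg (whithamKernel_nonneg x)]
    gcongr
    · exact whithamKernel_nonneg x
    · exact mul_le_of_le_one_left (abs_nonneg x) hη
  · have : Continuous fun η : ℝ ↦ exp (η * |x|) * whithamKernel x := by fun_prop
    simpa using (this.tendsto 0).mono_left nhdsWithin_le_nhds

/-- A weighted supremum estimate: `K * f` inherits a bound by the truncated weight
`min (exp (η|x|)) N` from `f`, with loss `∫ exp (η|z|) K z`. -/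
lemma min_exp_mul_lop_whithamKernel_le {f : ℝ → ℝ} (hf : Continuous f) {C : ℝ}
    (hC : ∀ x, |f x| ≤ C) (hf0 : ∀ x, 0 ≤ f x) {η N M : ℝ} (hη0 : 0 ≤ η) (hη : η ≤ 1)
    (hN : 0 ≤ N) (hM : ∀ x, min (exp (η * |x|)) N * f x ≤ M) (x : ℝ) :
    min (exp (η * |x|)) N * Lop whithamKernel f x ≤
      (∫ z, exp (η * |z|) * whithamKernel z) * M := by
  rw [lop_eq_integral, ← integral_const_mul, ← integral_mul_const]
  refine integral_mono ((integrable_whithamKernel_mul hf hC x).const_mul _)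
    ((integrable_exp_mul_abs_mul_whithamKernel hη).mul_const M) fun z ↦ ?_
  have hw : min (exp (η * |x|)) N ≤ exp (η * |z|) * min (exp (η * |x - z|)) N := by
    rw [mul_min_of_nonneg _ _ (exp_pos _).le, ← exp_add, ← mul_add]
    refine min_le_min ?_ (le_mul_of_one_le_left hN (one_le_exp (by positivity)))
    gcongr
    simpa using abs_add_le z (x - z)
  calc min (exp (η * |x|)) N * (whithamKernel z * f (x - z))
      ≤ exp (η * |z|) * min (exp (η * |x - z|)) N * (whithamKernel z * f (x - z)) :=
        mul_le_mul_of_nonneg_right hw (mul_nonneg (whithamKernel_nonneg z) (hf0 _))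
    _ = exp (η * |z|) * whithamKernel z * (min (exp (η * |x - z|)) N * f (x - z)) := by ring
    _ ≤ exp (η * |z|) * whithamKernel z * M :=
        mul_le_mul_of_nonneg_left (hM _) (mul_nonneg (exp_pos _).le (whithamKernel_nonneg z))

/-- Nonnegative solutions of the steady Whitham equation with supercritical speed `μ > 1` that
vanish at infinity decay exponentially. -/
lemma exists_exp_mul_abs_mul_le {f : ℝ → ℝ} (hf : Continuous f) {C μ : ℝ}
    (hC : ∀ x, |f x| ≤ C) (hf0 : ∀ x, 0 ≤ f x) (hμ : 1 < μ)
    (htop : Tendsto f atTop (𝓝 0)) (hbot : Tendsto f atBot (𝓝 0))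
    (hsol : ∀ x, f x * (μ - f x) = Lop whithamKernel f x) :
    ∃ η > 0, ∃ B, ∀ x, exp (η * |x|) * f x ≤ B := by
  set δ := (μ - 1) / 2 with hδ
  have hδ0 : 0 < δ := by linarith
  obtain ⟨R₁, hR₁⟩ := eventually_atTop.1 (htop.eventually_le_const hδ0)
  obtain ⟨R₂, hR₂⟩ := eventually_atBot.1 (hbot.eventually_le_const hδ0)
  set R := max R₁ (-R₂)
  have hsmall (x : ℝ) (hx : R ≤ |x|) : f x ≤ δ := by
    rcases abs_cases x with ⟨h, -⟩ | ⟨h, -⟩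
    · exact hR₁ x ((le_max_left _ _).trans (hx.trans h.le))
    · exact hR₂ x (by linarith [(le_max_right R₁ (-R₂)).trans (hx.trans h.le)])
  have hη_small : ∀ᶠ η : ℝ in 𝓝[>] 0, η ≤ 1 :=
    nhdsWithin_le_nhds (eventually_le_nhds zero_lt_one)
  obtain ⟨η, hb, hη1, hη0 : 0 < η⟩ :=
    ((tendsto_integral_exp_mul_abs_mul_whithamKernel.eventually_lt_const
      (show 1 < 1 + δ by linarith)).and (hη_small.and self_mem_nhdsWithin)).exists
  have hC0 : 0 ≤ C := (abs_nonneg _).trans (hC 0)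
  refine ⟨η, hη0, exp (η * R) * C, fun y ↦ ?_⟩
  set N := exp (η * |y|)
  set b := ∫ z, exp (η * |z|) * whithamKernel z
  have hN : 0 ≤ N := (exp_pos _).le
  set g : ℝ → ℝ := fun x ↦ min (exp (η * |x|)) N * f x
  have hg0 (x : ℝ) : 0 ≤ g x := mul_nonneg (le_min (exp_pos _).le hN) (hf0 x)
  have hgbdd : BddAbove (Set.range g) := ⟨N * C, by
    rintro _ ⟨x, rfl⟩
    exact mul_le_mul (min_le_right _ _) ((le_abs_self _).trans (hC x)) (hf0 x) hN⟩
  set M := ⨆ x, g x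
  have hM0 : 0 ≤ M := (hg0 0).trans (le_ciSup hgbdd 0)
  have hMmax : M ≤ max (exp (η * R) * C) (b * M / (1 + δ)) := by
    refine ciSup_le fun x ↦ ?_
    rcases le_total R |x| with hx | hx
    · refine le_max_of_le_right ((le_div_iff₀ (by linarith)).2 ?_)
      calc g x * (1 + δ) = min (exp (η * |x|)) N * (f x * (1 + δ)) := by ring
        _ ≤ min (exp (η * |x|)) N * Lop whithamKernel f x := by
          rw [← hsol x]
          have := hsmall x hx
          exact mul_le_mul_of_nonneg_left (mul_le_mul_of_nonneg_left (by linarith) (hf0 x))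
            (le_min (exp_pos _).le hN)
        _ ≤ b * M := min_exp_mul_lop_whithamKernel_le hf hC hf0 hη0.le hη1 hN
          (le_ciSup hgbdd) x
    · refine le_max_of_le_left (mul_le_mul ((min_le_left _ _).trans ?_)
        ((le_abs_self _).trans (hC x)) (hf0 x) (exp_pos _).le)
      gcongr
  have hMle : M ≤ exp (η * R) * C := by
    rcases le_max_iff.1 hMmax with h | h
    · exact h
    · rw [le_div_iff₀ (by linarith)] at h
      have : M ≤ 0 := by nlinarith
      exact this.trans (by positivity)
  simpa [g, N] using (le_ciSup hgbdd y).trans hMle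

lemma integrable_exp_mul_abs_mul {f : ℝ → ℝ} (hf : Continuous f) (hf0 : ∀ x, 0 ≤ f x) {η B : ℝ}
    (hη : 0 < η) (hB : ∀ x, exp (η * |x|) * f x ≤ B) :
    Integrable fun x ↦ exp (η / 2 * |x|) * f x := by
  have h : Integrable fun x : ℝ ↦ exp (-(η / 2) * |x|) := by
    rw [← integrableOn_univ, ← Set.Iic_union_Ioi (a := (0 : ℝ))]
    refine .union ?_ ?_
    · refine (integrableOn_exp_mul_Iic (half_pos hη) 0).congr_fun (fun x hx ↦ ?_) measurableSet_Iic
      simp [abs_of_nonpos (Set.mem_Iic.1 hx)]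
    · refine (integrableOn_exp_mul_Ioi (neg_neg_of_pos (half_pos hη)) 0).congr_fun (fun x hx ↦ ?_)
        measurableSet_Ioi
      simp [abs_of_pos (Set.mem_Ioi.1 hx)]
  refine (h.const_mul B).mono' (Continuous.aestronglyMeasurable (by fun_prop))
    (.of_forall fun x ↦ ?_)
  rw [Real.norm_eq_abs, abs_of_nonneg (mul_nonneg (exp_pos _).le (hf0 x))]
  calc exp (η / 2 * |x|) * f x = exp (η * |x|) * f x * exp (-(η / 2) * |x|) := by
        rw [mul_right_comm, ← exp_add]
        ring_nf
    _ ≤ B * exp (-(η / 2) * |x|) := mul_le_mul_of_nonneg_right (hB x) (exp_pos _).le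

lemma exists_tendsto_of_even_of_strictMonoOn {f : ℝ → ℝ} {m : ℝ} (heven : ∀ x, f (-x) = f x)
    (hmono : StrictMonoOn f (Set.Iic 0)) (hm : ∀ x, m ≤ f x) :
    ∃ c, Tendsto f atTop (𝓝 c) ∧ Tendsto f atBot (𝓝 c) ∧ ∀ x, c < f x := by
  have hbdd : BddBelow (Set.range fun x ↦ f (min x 0)) := ⟨m, by rintro _ ⟨x, rfl⟩; exact hm _⟩
  have hmono' : Monotone fun x ↦ f (min x 0) := fun x y hxy ↦
    hmono.monotoneOn (Set.mem_Iic.2 (min_le_right x 0)) (Set.mem_Iic.2 (min_le_right y 0))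
      (min_le_min_right 0 hxy)
  have hbot : Tendsto f atBot (𝓝 (⨅ x, f (min x 0))) :=
    (tendsto_atBot_ciInf hmono' hbdd).congr' <| by
      filter_upwards [eventually_le_atBot 0] with x hx
      rw [min_eq_left hx]
  refine ⟨_, (hbot.comp tendsto_neg_atTop_atBot).congr heven, hbot, fun x ↦ ?_⟩
  have hx : f (-|x|) = f x := by
    rcases abs_choice x with h | h <;> simp [h, heven]
  have hneg : -|x| ≤ 0 := by simp
  calc ⨅ x, f (min x 0) ≤ f (min (-|x| - 1) 0) := ciInf_le hbdd _
    _ = f (-|x| - 1) := by rw [min_eq_left (by linarith)]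
    _ < f (-|x|) := hmono (show -|x| - 1 ≤ 0 by linarith) hneg (by linarith)
    _ = f x := hx

lemma strictAntiOn_Ici_of_even {f : ℝ → ℝ} (heven : ∀ x, f (-x) = f x)
    (hmono : StrictMonoOn f (Set.Iic 0)) : StrictAntiOn f (Set.Ici 0) := by
  intro x hx y hy hxy
  rw [← heven x, ← heven y]
  exact hmono (Set.mem_Iic.2 (neg_nonpos.2 hy)) (Set.mem_Iic.2 (neg_nonpos.2 hx)) (neg_lt_neg hxy)

lemma lt_apply_zero_of_even {f : ℝ → ℝ} (heven : ∀ x, f (-x) = f x)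
    (hmono : StrictMonoOn f (Set.Iic 0)) {x : ℝ} (hx : x ≠ 0) : f x < f 0 := by
  rcases hx.lt_or_gt with h | h
  · exact hmono h.le Set.self_mem_Iic h
  · exact strictAntiOn_Ici_of_even heven hmono Set.self_mem_Ici h.le h

/-- `K * f` does not vanish at `0` when `f` is negative off the origin. -/
lemma lop_whithamKernel_zero_ne_zero {f : ℝ → ℝ} (hf : Continuous f) {C : ℝ} (hC : ∀ x, |f x| ≤ C)
    (hneg : ∀ x ≠ 0, f x < 0) : Lop whithamKernel f 0 ≠ 0 := by
  intro h0
  have hf0 (x : ℝ) (hx : x ≠ 0) : f (0 - x) < 0 := hneg _ (by simpa using hx)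
  have hint := integrable_whithamKernel_mul hf hC 0
  rw [lop_eq_integral, ← neg_eq_zero, ← integral_neg] at h0
  replace h0 := (integral_eq_zero_iff_of_nonneg_ae ?_ hint.neg).1 h0
  · have hK : whithamKernel =ᵐ[volume] 0 := by
      filter_upwards [h0, ae_ne_zero] with x hx hx0
      simpa [(hneg (-x) (neg_ne_zero.2 hx0)).ne] using hx
    simpa [integral_congr_ae hK] using integral_whithamKernel
  · filter_upwards [ae_ne_zero] with x hx
    exact neg_nonneg.2 (mul_nonpos_of_nonneg_of_nonpos (whithamKernel_nonneg x) (hf0 x hx).le)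

theorem galilean_transform_yields_solitary_wave
    (lam : ℝ) (hlam : lam ∈ Set.Ioc (0:ℝ) 1)
    (φ : ℝ → ℝ) (ν : ℝ) (hν : ν ∈ Set.Icc (0:ℝ) 1)
    (hcont : Continuous φ) (hbdd : ∃ C : ℝ, ∀ x : ℝ, |φ x| ≤ C)
    (hsol : ∀ x : ℝ, -ν * φ x + Lop whithamKernel φ x + (φ x) ^ 2 = 0)
    (heven : ∀ x : ℝ, φ (-x) = φ x)
    (hnonconst : ∃ x y : ℝ, φ x ≠ φ y)
    (hmono : StrictMonoOn φ (Set.Iic (0:ℝ)))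
    (hbounds : ∀ x : ℝ, ν - 1 ≤ φ x ∧ φ x ≤ lam * ν / 2)
    (hheight : φ 0 = lam * ν / 2) :
    ν ∈ Set.Ioo (0:ℝ) 1 ∧
    (2 - ν) ∈ Set.Ioo (1:ℝ) 2 ∧
    (∀ x : ℝ, -(2 - ν) * (φ x + 1 - ν) +
        Lop whithamKernel (fun y => φ y + 1 - ν) x + (φ x + 1 - ν) ^ 2 = 0) ∧
    (∀ x : ℝ, 0 < φ x + 1 - ν) ∧
    (∀ x : ℝ, φ (-x) + 1 - ν = φ x + 1 - ν) ∧
    StrictAntiOn (fun x : ℝ => φ x + 1 - ν) (Set.Ici (0:ℝ)) ∧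
    (∀ x : ℝ, φ x + 1 - ν ≤ (2 - ν) - 1 + lam * (1 - (2 - ν) / 2)) ∧
    (∀ x : ℝ, φ x + 1 - ν = (2 - ν) - 1 + lam * (1 - (2 - ν) / 2) ↔ x = 0) ∧
    Tendsto (fun x : ℝ => φ x + 1 - ν) atTop (nhds 0) ∧
    Tendsto (fun x : ℝ => φ x + 1 - ν) atBot (nhds 0) ∧
    (∃ η : ℝ, 0 < η ∧
      Integrable (fun x : ℝ => Real.exp (η * |x|) * (φ x + 1 - ν)) ∧
      ∃ C : ℝ, ∀ x : ℝ, |Real.exp (η * |x|) * (φ x + 1 - ν)| ≤ C) := by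
  obtain ⟨C, hC⟩ := hbdd
  obtain ⟨c, htop, hbot, hlt⟩ :=
    exists_tendsto_of_even_of_strictMonoOn heven hmono fun x ↦ (hbounds x).1
  have hpeak {x : ℝ} (hx : x ≠ 0) : φ x < φ 0 := lt_apply_zero_of_even heven hmono hx
  have hc0 : c ≠ 0 := by
    rintro rfl
    refine (hlt 1).ne' (eq_zero_of_sq_le_sub_lop hcont hC htop hbot (fun x ↦ ?_) 1)
    nlinarith [hsol x, hlt x, hν.2]
  have hc : c = ν - 1 := by
    have h := ((htop.const_mul (-ν)).add (tendsto_lop_whithamKernel hcont hC htop)).add (htop.pow 2)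
    have h0 : -ν * c + c + c ^ 2 = 0 := tendsto_nhds_unique h
      (by simp_rw [hsol]; exact tendsto_const_nhds)
    have h1 : c * (c - (ν - 1)) = 0 := by linear_combination h0
    linarith [(mul_eq_zero.1 h1).resolve_left hc0]
  have hν1 : ν < 1 := hν.2.lt_of_ne fun h ↦ hc0 (by rw [hc, h, sub_self])
  have hν0 : 0 < ν := hν.1.lt_of_ne <| by
    rintro rfl
    have h0 : φ 0 = 0 := by simpa using hheight
    exact lop_whithamKernel_zero_ne_zero hcont hC (fun x hx ↦ (hpeak hx).trans_eq h0)
      (by simpa [h0] using hsol 0)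
  have hpos (x : ℝ) : 0 < φ x + 1 - ν := by linarith [hlt x]
  have hψcont : Continuous fun x ↦ φ x + 1 - ν := by fun_prop
  have hψsol (x : ℝ) : -(2 - ν) * (φ x + 1 - ν) +
      Lop whithamKernel (fun y => φ y + 1 - ν) x + (φ x + 1 - ν) ^ 2 = 0 := by
    simp_rw [add_sub_assoc]
    rw [lop_whithamKernel_add_const hcont hC]
    linear_combination hsol x
  have hψbdd (x : ℝ) : |φ x + 1 - ν| ≤ φ 0 + 1 - ν := by
    rw [abs_of_pos (hpos x)]
    linarith [(hbounds x).2]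
  have hlimit {l : Filter ℝ} (h : Tendsto φ l (𝓝 c)) :
      Tendsto (fun x ↦ φ x + 1 - ν) l (𝓝 0) := by
    simpa [hc] using (h.add_const 1).sub_const ν
  obtain ⟨η, hη, B, hB⟩ := exists_exp_mul_abs_mul_le hψcont hψbdd (fun x ↦ (hpos x).le)
    (show 1 < 2 - ν by linarith) (hlimit htop) (hlimit hbot)
    fun x ↦ by linear_combination -hψsol x
  refine ⟨⟨hν0, hν1⟩, ⟨by linarith, by linarith⟩, hψsol, hpos, fun x ↦ by rw [heven],
    fun x hx y hy hxy ↦ ?_, fun x ↦ by linarith [(hbounds x).2], fun x ↦ ⟨fun h ↦ ?_, ?_⟩,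
    hlimit htop, hlimit hbot, η / 2, half_pos hη,
    integrable_exp_mul_abs_mul hψcont (fun x ↦ (hpos x).le) hη hB, B, fun x ↦ ?_⟩
  · have := strictAntiOn_Ici_of_even heven hmono hx hy hxy
    simpa using this
  · by_contra hx
    linarith [hpeak hx]
  · rintro rfl
    linarith
  · rw [abs_of_nonneg (mul_nonneg (exp_pos _).le (hpos x).le)]
    refine le_trans (mul_le_mul_of_nonneg_right ?_ (hpos x).le) (hB x)
    gcongr
    linarith
end

section
/- Let K : ℝ → ℝ be strictly positive, measurable and integrable with ∫_ℝ K = 1. Let φ and φ̃ be continuous solutions of the steady Whitham equation (relative to K) with wave speeds μ and μ̃ respectively, where μ, μ̃ ∈ (1,2) and μ ≥ μ̃, such that 0 < φ(x) ≤ μ/2 and 0 < φ̃(x) ≤ μ̃/2 for all x, and lim_{x→±∞} φ(x) = lim_{x→±∞} φ̃(x) = 0. Suppose the difference ψ := φ̃ − φ attains strictly negative values. Then at every point x* where ψ attains its global minimum over ℝ, one has μ − φ(x*) − φ̃(x*) < 1. -/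
open Real Filter MeasureTheory

/-- A solution of the steady Whitham equation with wave speed `μ`, relative to the
kernel `K`: a bounded measurable `φ` satisfying `−μφ + Lφ + φ² = 0` pointwise. -/
def IsSolution (K : ℝ → ℝ) (μ : ℝ) (φ : ℝ → ℝ) : Prop :=
  Measurable φ ∧ (∃ C : ℝ, ∀ x : ℝ, |φ x| ≤ C) ∧
    ∀ x : ℝ, -μ * φ x + Lop K φ x + (φ x) ^ 2 = 0
/-- Averaging against a strictly positive kernel of unit mass strictly raises the value `m` when
the averaged function is at least `m` everywhere and eventually exceeds `m`. -/
lemma lt_Lop_of_le_of_eventually_lt {K f : ℝ → ℝ} {m C : ℝ}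
    (hKpos : ∀ x : ℝ, 0 < K x) (hKint : Integrable K) (hKone : (∫ x : ℝ, K x) = 1)
    (hfmeas : Measurable f) (hfC : ∀ x : ℝ, |f x| ≤ C) (hle : ∀ x : ℝ, m ≤ f x)
    (hlt : ∀ᶠ x in atTop, m < f x) (x : ℝ) : m < Lop K f x := by
  have hK : Integrable (fun y => K (x - y)) := hKint.comp_sub_left x
  have hKf : Integrable (fun y => K (x - y) * f y) :=
    hK.mul_bdd (c := C) hfmeas.aestronglyMeasurable (.of_forall hfC)
  have hKm : Integrable (fun y => K (x - y) * m) := hK.mul_const m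
  have hmass : (∫ y, K (x - y) * m) = m := by
    rw [integral_mul_const, integral_sub_left_eq_self K volume x, hKone, one_mul]
  have hpos : 0 < ∫ y, (K (x - y) * f y - K (x - y) * m) := by
    refine (integral_pos_iff_support_of_nonneg ?_ (hKf.sub hKm)).2 ?_
    · intro y
      simp only [Pi.zero_apply, Pi.sub_apply, ← mul_sub]
      exact mul_nonneg (hKpos _).le (sub_nonneg.2 (hle y))
    · obtain ⟨N, hN⟩ := eventually_atTop.1 hlt
      refine lt_of_lt_of_le (b := volume (Set.Ici N)) (by simp) (measure_mono fun y hy => ?_)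
      rw [Function.mem_support, Pi.sub_apply, ← mul_sub]
      exact (mul_pos (hKpos _) (sub_pos.2 (hN y hy))).ne'
  rw [integral_sub hKf hKm, hmass] at hpos
  exact sub_pos.1 hpos

/-- The convolution operator is additive under subtraction of bounded measurable functions. -/
lemma Lop_sub {K f g : ℝ → ℝ} {C D : ℝ} (hKint : Integrable K)
    (hf : Measurable f) (hfC : ∀ x : ℝ, |f x| ≤ C)
    (hg : Measurable g) (hgD : ∀ x : ℝ, |g x| ≤ D) (x : ℝ) :
    Lop K (fun y => f y - g y) x = Lop K f x - Lop K g x := by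
  have hK : Integrable (fun y => K (x - y)) := hKint.comp_sub_left x
  simp only [Lop, mul_sub]
  exact integral_sub (hK.mul_bdd (c := C) hf.aestronglyMeasurable (.of_forall hfC))
    (hK.mul_bdd (c := D) hg.aestronglyMeasurable (.of_forall hgD))

theorem sign_shifting_minimum_location (K : ℝ → ℝ)
    (hKmeas : Measurable K) (hKpos : ∀ x : ℝ, 0 < K x)
    (hKint : Integrable K) (hKone : (∫ x : ℝ, K x) = 1)
    (φ φt : ℝ → ℝ) (μ μt : ℝ)
    (hμ : μ ∈ Set.Ioo (1:ℝ) 2) (hμt : μt ∈ Set.Ioo (1:ℝ) 2) (hμge : μt ≤ μ)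
    (hφcont : Continuous φ) (hφtcont : Continuous φt)
    (hφ : IsSolution K μ φ) (hφt : IsSolution K μt φt)
    (hφrange : ∀ x : ℝ, 0 < φ x ∧ φ x ≤ μ / 2)
    (hφtrange : ∀ x : ℝ, 0 < φt x ∧ φt x ≤ μt / 2)
    (hφtop : Tendsto φ atTop (nhds 0)) (hφbot : Tendsto φ atBot (nhds 0))
    (hφttop : Tendsto φt atTop (nhds 0)) (hφtbot : Tendsto φt atBot (nhds 0))
    (hneg : ∃ x : ℝ, φt x - φ x < 0) :
    ∀ xs : ℝ, (∀ x : ℝ, φt xs - φ xs ≤ φt x - φ x) →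
      μ - φ xs - φt xs < 1 := by
  intro xs hmin
  obtain ⟨hm, ⟨C, hC⟩, heq⟩ := hφ
  obtain ⟨hmt, ⟨D, hD⟩, heqt⟩ := hφt
  obtain ⟨x₀, hx₀⟩ := hneg
  have hmneg : φt xs - φ xs < 0 := (hmin x₀).trans_lt hx₀
  have hlim : Tendsto (fun x => φt x - φ x) atTop (nhds 0) := by
    simpa using hφttop.sub hφtop
  have hL := lt_Lop_of_le_of_eventually_lt hKpos hKint hKone (hmt.sub hm)
    (C := D + C) (fun x => (abs_sub _ _).trans (add_le_add (hD x) (hC x))) hmin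
    (hlim.eventually_const_lt hmneg) xs
  have hsub := Lop_sub hKint hmt hD hm hC xs
  have hdefect : 0 ≤ (μ - μt) * φt xs :=
    mul_nonneg (sub_nonneg.2 hμge) (hφtrange xs).1.le
  have hkey : φt xs - φ xs < (φt xs - φ xs) * (μ - φ xs - φt xs) := by
    change _ < Lop K (fun y => φt y - φ y) xs at hL
    linarith [heq xs, heqt xs]
  by_contra! h
  nlinarith [mul_nonneg (neg_nonneg.2 hmneg.le) (sub_nonneg.2 h)]
end
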